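/- arXiv:2501.13323 — 2 statements merged into one kernel-verified Lean document; each statement's English description precedes it below -/
import Mathlib

section
/- Consider the linear regression model y = Xβ + z with σ = 1 and β ∈ ℝ^m, all of m = m_n and μ = μ_n depending on n. Let π_{±S}(μ; m) be the symmetric spike prior. Suppose n → ∞, m → ∞, (log m)/n → 0, μ → ∞, μ = o(√(log m)) and μ⁴/n → 0. Then the Bayes risk satisfies B(π_{±S}(μ; m)) ≥ μ² − (μ²e^{μ²}/(2m))·(1+o(1)); equivalently, limsup_n (μ² − B(π_{±S}(μ;m))) · 2m/(μ²e^{μ²}) ≤ 1. -/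
open MeasureTheory ProbabilityTheory Filter
open scoped NNReal ENNReal

noncomputable section

/-- Sample space for the Bayesian model with symmetric spike prior: a design matrix
`X ∈ ℝ^{n×m}`, a noise vector `z ∈ ℝ^n`, a spike location `I ∈ [m]` and a sign. -/
abbrev PMOmega (n m : ℕ) : Type :=
  ((Fin n → Fin m → ℝ) × (Fin n → ℝ)) × (Fin m × Bool)

/-- The joint law: design entries i.i.d. `N(0, 1/n)`, noise entries i.i.d. `N(0,1)`,
an independent uniform spike location in `[m]` and an independent fair sign. -/
def pmLaw (n m : ℕ) : Measure (PMOmega n m) :=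
  ((Measure.pi fun _ : Fin n => Measure.pi fun _ : Fin m => gaussianReal 0 (n : ℝ≥0)⁻¹).prod
    (Measure.pi fun _ : Fin n => gaussianReal 0 1)).prod
    ((((m : ℝ≥0∞))⁻¹ • Measure.count).prod (((2 : ℝ≥0∞))⁻¹ • Measure.count))

/-- The signal drawn from the symmetric spike prior `π_{±S}(μ; m)`: `β = ε μ e_I`. -/
def pmSignal (m : ℕ) (mu : ℝ) (Iε : Fin m × Bool) : Fin m → ℝ :=
  fun j => if j = Iε.1 then (if Iε.2 then mu else -mu) else 0

/-- The observed data `(X, y)` with `y = X β + z`. -/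
def pmData (n m : ℕ) (mu : ℝ) (ω : PMOmega n m) :
    (Fin n → Fin m → ℝ) × (Fin n → ℝ) :=
  (ω.1.1, fun i => (∑ j, ω.1.1 i j * pmSignal m mu ω.2 j) + ω.1.2 i)

/-- The Bayes risk `B(π_{±S}(μ; m)) = inf_{β̂} E_π ‖β̂(X,y) − β‖₂²`, the infimum over
all measurable estimators. -/
def pmBayesRisk (n m : ℕ) (mu : ℝ) : ℝ≥0∞ :=
  ⨅ (est : (Fin n → Fin m → ℝ) × (Fin n → ℝ) → Fin m → ℝ) (_ : Measurable est),
    ∫⁻ ω, ENNReal.ofReal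
      (∑ j, (est (pmData n m mu ω) j - pmSignal m mu ω.2 j) ^ 2) ∂ pmLaw n m

theorem lintegral_pi_prod_eval {ι : Type*} [Fintype ι] {E : ι → Type*}
    [∀ i, MeasurableSpace (E i)] (μ : ∀ i, Measure (E i)) [∀ i, IsProbabilityMeasure (μ i)]
    (s : Finset ι) (f : ∀ i, E i → ℝ≥0∞) (hf : ∀ i, Measurable (f i)) :
    ∫⁻ x, ∏ i ∈ s, f i (x i) ∂Measure.pi μ = ∏ i ∈ s, ∫⁻ t, f i t ∂μ i := by
  refine (lintegral_prod_eq_prod_lintegral_of_indepFun s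
    (fun (i : ι) (x : ∀ i, E i) => f i (x i))
    (iIndepFun_pi (μ := μ) (X := f) fun i => (hf i).aemeasurable)
    (fun i => (hf i).comp (measurable_pi_apply i))).trans ?_
  refine Finset.prod_congr rfl fun i _ => ?_
  exact (measurePreserving_eval μ i).lintegral_comp (hf i)

theorem lintegral_exp_quadratic_gaussianReal {v : ℝ≥0} (hv : v ≠ 0) (b c : ℝ)
    (hc : 0 < 1 + 2 * c * v) :
    ∫⁻ x, ENNReal.ofReal (Real.exp (b * x - c * x ^ 2)) ∂gaussianReal 0 v =
      ENNReal.ofReal ((√(1 + 2 * c * v))⁻¹ *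
        Real.exp (b ^ 2 * v / (2 * (1 + 2 * c * v)))) := by
  set q : ℝ := 1 + 2 * c * v with hq
  have hv0 : (0 : ℝ) < v := by positivity
  let w : ℝ≥0 := ⟨v / q, by positivity⟩
  have hwr : (w : ℝ) = v / q := rfl
  have hw : w ≠ 0 := by
    intro h
    have : (w : ℝ) = 0 := by rw [h]; rfl
    rw [hwr] at this
    exact (by positivity : (v : ℝ) / q ≠ 0) this
  rw [gaussianReal_of_var_ne_zero _ hv,
    lintegral_withDensity_eq_lintegral_mul _ (measurable_gaussianPDF 0 v) (by fun_prop)]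
  have key : ∀ x, (gaussianPDF 0 v * fun x => ENNReal.ofReal (Real.exp (b * x - c * x ^ 2))) x =
      ENNReal.ofReal ((√q)⁻¹ * Real.exp (b ^ 2 * v / (2 * q))) *
        ENNReal.ofReal (gaussianPDFReal (b * v / q) w x) := by
    intro x
    rw [Pi.mul_apply, gaussianPDF_def, ← ENNReal.ofReal_mul (gaussianPDFReal_nonneg _ _ _),
      ← ENNReal.ofReal_mul (by positivity)]
    congr 1
    simp only [gaussianPDFReal, hwr]
    have h1 : √(2 * Real.pi * (v / q)) = √(2 * Real.pi * v) / √q := by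
      rw [← Real.sqrt_div (by positivity)]; congr 1; ring
    have hs : 0 < √q := Real.sqrt_pos.mpr hc
    have hs' : 0 < √(2 * Real.pi * v) := Real.sqrt_pos.mpr (by positivity)
    rw [h1]
    have h2 : -(x - 0) ^ 2 / (2 * v) + (b * x - c * x ^ 2) =
        b ^ 2 * v / (2 * q) + -(x - b * v / q) ^ 2 / (2 * (v / q)) := by
      field_simp
      rw [hq]; ring
    calc _ = (√(2 * Real.pi * v))⁻¹ *
        Real.exp (-(x - 0) ^ 2 / (2 * v) + (b * x - c * x ^ 2)) := by rw [Real.exp_add]; ring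
      _ = _ := by rw [h2, Real.exp_add]; field_simp
  simp_rw [key]
  rw [lintegral_const_mul' _ _ ENNReal.ofReal_ne_top, lintegral_gaussianPDFReal_eq_one _ hw, mul_one]

theorem gaussianReal_map_const_add_eq_withDensity (θ : ℝ) :
    (gaussianReal 0 1).map (θ + ·) =
      (gaussianReal 0 1).withDensity fun t => ENNReal.ofReal (Real.exp (θ * t - θ ^ 2 / 2)) := by
  rw [gaussianReal_map_const_add, gaussianReal_of_var_ne_zero _ one_ne_zero,
    gaussianReal_of_var_ne_zero _ one_ne_zero,
    ← withDensity_mul _ (measurable_gaussianPDF _ _) (by fun_prop)]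
  congr 1
  ext t
  rw [Pi.mul_apply, gaussianPDF_def, gaussianPDF_def,
    ← ENNReal.ofReal_mul (gaussianPDFReal_nonneg _ _ _)]
  simp only [gaussianPDFReal, mul_assoc, ← Real.exp_add]
  congr 4
  simp
  ring

theorem lintegral_gaussian_shift {n : ℕ} (θ : Fin n → ℝ) (f : (Fin n → ℝ) → ℝ≥0∞)
    (hf : Measurable f) :
    ∫⁻ z, f (fun i => θ i + z i) ∂Measure.pi (fun _ : Fin n => gaussianReal 0 1) =
      ∫⁻ z, ENNReal.ofReal (Real.exp (∑ i, (θ i * z i - θ i ^ 2 / 2))) * f z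
        ∂Measure.pi (fun _ : Fin n => gaussianReal 0 1) := by
  have hD : Measurable fun z : Fin n → ℝ =>
      ENNReal.ofReal (Real.exp (∑ i, (θ i * z i - θ i ^ 2 / 2))) := by fun_prop
  have hmap : (Measure.pi (fun _ : Fin n => gaussianReal 0 1)).map (fun z i => θ i + z i) =
      (Measure.pi (fun _ : Fin n => gaussianReal 0 1)).withDensity
        fun z => ENNReal.ofReal (Real.exp (∑ i, (θ i * z i - θ i ^ 2 / 2))) := by
    have : ∀ i, IsProbabilityMeasure ((gaussianReal 0 1).map (θ i + ·)) := fun i =>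
      Measure.isProbabilityMeasure_map (by fun_prop)
    rw [Measure.pi_map_pi (μ := fun _ : Fin n => gaussianReal 0 1) (f := fun i t => θ i + t)
      (fun i => by fun_prop)]
    refine Measure.pi_eq fun s hs => ?_
    rw [withDensity_apply _ (MeasurableSet.univ_pi hs), ← lintegral_indicator (MeasurableSet.univ_pi hs)]
    have : ∀ z : Fin n → ℝ, (Set.univ.pi s).indicator
        (fun z => ENNReal.ofReal (Real.exp (∑ i, (θ i * z i - θ i ^ 2 / 2)))) z =
        ∏ i, (s i).indicator
          (fun t => ENNReal.ofReal (Real.exp (θ i * t - θ i ^ 2 / 2))) (z i) := by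
      intro z
      by_cases hz : z ∈ Set.univ.pi s
      · rw [Set.indicator_of_mem hz, Real.exp_sum,
          ENNReal.ofReal_prod_of_nonneg fun i _ => (Real.exp_pos _).le]
        exact Finset.prod_congr rfl fun i _ => by rw [Set.indicator_of_mem (hz i trivial)]
      · rw [Set.indicator_of_notMem hz]
        simp only [Set.mem_univ_pi, not_forall] at hz
        obtain ⟨i, hi⟩ := hz
        exact (Finset.prod_eq_zero (Finset.mem_univ i) (Set.indicator_of_notMem hi _)).symm
    simp_rw [this]
    rw [lintegral_pi_prod_eval _ Finset.univ _ fun i => Measurable.indicator (by fun_prop) (hs i)]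
    refine Finset.prod_congr rfl fun i _ => ?_
    rw [gaussianReal_map_const_add_eq_withDensity, withDensity_apply _ (hs i),
      lintegral_indicator (hs i)]
  refine (lintegral_map hf (g := fun (z : Fin n → ℝ) i => θ i + z i) (by fun_prop)).symm.trans ?_
  rw [hmap, lintegral_withDensity_eq_lintegral_mul _ hD hf]
  rfl

theorem measurePreserving_swap_pi {ι κ E : Type*} [Fintype ι] [Fintype κ] [MeasurableSpace E]
    (μ : Measure E) [IsProbabilityMeasure μ] :
    MeasurePreserving (fun (X : ι → κ → E) j i => X i j)
      (Measure.pi fun _ : ι => Measure.pi fun _ : κ => μ)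
      (Measure.pi fun _ : κ => Measure.pi fun _ : ι => μ) := by
  refine ⟨by fun_prop, ?_⟩
  have h1 := Measure.infinitePi_map_curry_symm (fun (_ : ι) (_ : κ) => μ)
  have h2 := Measure.infinitePi_map_curry (fun (_ : κ) (_ : ι) => μ)
  have h3 := Measure.infinitePi_map_piCongrLeft (fun _ : κ × ι => μ) (Equiv.prodComm ι κ)
  simp only [Measure.infinitePi_eq_pi] at h1 h2 h3
  rw [← h2, ← h3, ← h1, Measure.map_map (by fun_prop) (by fun_prop),
    Measure.map_map (by fun_prop) (by fun_prop)]
  congr 1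

theorem exp_neg_le_quadratic {t : ℝ} (ht : 0 ≤ t) : Real.exp (-t) ≤ 1 - t + t ^ 2 / 2 := by
  have h := Real.quadratic_le_exp_of_nonneg ht
  rw [Real.exp_neg, inv_le_iff_one_le_mul₀ (Real.exp_pos t)]
  have h1 : 0 ≤ 1 - t + t ^ 2 / 2 := by nlinarith [sq_nonneg (t - 1)]
  nlinarith [mul_le_mul_of_nonneg_left h h1, sq_nonneg (t ^ 2)]

theorem exp_neg_le_two_div_sq {x : ℝ} (hx : 0 < x) : Real.exp (-x) ≤ 2 / x ^ 2 := by
  have h := Real.quadratic_le_exp_of_nonneg hx.le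
  rw [Real.exp_neg, inv_le_comm₀ (Real.exp_pos x) (by positivity), inv_div]
  linarith

theorem lintegral_exp_neg_mul_le {E : Type*} [MeasurableSpace E] (ν : Measure E)
    [IsProbabilityMeasure ν] {w : E → ℝ} (hw : Measurable w) (hw0 : ∀ x, 0 ≤ w x) {h g l : ℝ}
    (hh : 0 ≤ h) (hg : 0 ≤ g) (hl : 0 ≤ l)
    (h1 : ∫⁻ x, ENNReal.ofReal (w x) ∂ν = ENNReal.ofReal h)
    (h2 : ∫⁻ x, ENNReal.ofReal (w x ^ 2) ∂ν ≤ ENNReal.ofReal g) :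
    ∫⁻ x, ENNReal.ofReal (Real.exp (-(l * w x))) ∂ν ≤
      ENNReal.ofReal (Real.exp (-(l * h) + l ^ 2 * g / 2)) := by
  have hpt : ∀ x, ENNReal.ofReal (Real.exp (-(l * w x))) + ENNReal.ofReal l * ENNReal.ofReal (w x) ≤
      1 + ENNReal.ofReal (l ^ 2 / 2) * ENNReal.ofReal (w x ^ 2) := by
    intro x
    rw [← ENNReal.ofReal_mul hl, ← ENNReal.ofReal_add (Real.exp_pos _).le (mul_nonneg hl (hw0 x)),
      ← ENNReal.ofReal_mul (by positivity), ← ENNReal.ofReal_one,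
      ← ENNReal.ofReal_add zero_le_one (by positivity)]
    apply ENNReal.ofReal_le_ofReal
    have := exp_neg_le_quadratic (mul_nonneg hl (hw0 x))
    linarith [mul_pow l (w x) 2]
  have hint := lintegral_mono (μ := ν) hpt
  rw [lintegral_add_left (by fun_prop), lintegral_add_left (by fun_prop),
    lintegral_const_mul' _ _ ENNReal.ofReal_ne_top, lintegral_const_mul' _ _ ENNReal.ofReal_ne_top,
    h1, lintegral_one, measure_univ, ← ENNReal.ofReal_mul hl] at hint
  have hb : ∫⁻ x, ENNReal.ofReal (Real.exp (-(l * w x))) ∂ν + ENNReal.ofReal (l * h) ≤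
      ENNReal.ofReal (1 + l ^ 2 / 2 * g) := by
    refine hint.trans ?_
    rw [ENNReal.ofReal_add zero_le_one (by positivity), ENNReal.ofReal_one,
      ENNReal.ofReal_mul (by positivity)]
    gcongr
  calc _ ≤ ENNReal.ofReal (1 + l ^ 2 / 2 * g) - ENNReal.ofReal (l * h) :=
        ENNReal.le_sub_of_add_le_right ENNReal.ofReal_ne_top hb
    _ = ENNReal.ofReal (1 + l ^ 2 / 2 * g - l * h) :=
        (ENNReal.ofReal_sub _ (mul_nonneg hl hh)).symm
    _ ≤ _ := ENNReal.ofReal_le_ofReal (by linarith [Real.add_one_le_exp (-(l * h) + l ^ 2 * g / 2)])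

/-- Likelihood ratio of `N(θ x, I)` against `N(0, I)` at the observation `y`. -/
def spikeLik {n : ℕ} (θ : ℝ) (x y : Fin n → ℝ) : ℝ :=
  Real.exp (∑ i, (θ * y i * x i - θ ^ 2 / 2 * x i ^ 2))

theorem spikeLik_pos {n : ℕ} (θ : ℝ) (x y : Fin n → ℝ) : 0 < spikeLik θ x y := Real.exp_pos _

@[fun_prop]
theorem measurable_spikeLik {n : ℕ} {α : Type*} [MeasurableSpace α] (θ : ℝ)
    {f g : α → Fin n → ℝ} (hf : Measurable f) (hg : Measurable g) :
    Measurable fun a => spikeLik θ (f a) (g a) := by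
  unfold spikeLik
  fun_prop

/-- Mean of `spikeLik θ x y` over a design column `x`, with `s = θ² / n`. -/
def spikeMean {n : ℕ} (s : ℝ) (y : Fin n → ℝ) : ℝ :=
  ∏ i, ((√(1 + s))⁻¹ * Real.exp (s * y i ^ 2 / (2 * (1 + s))))

/-- Second moment of `spikeLik θ x y` over a design column `x`, with `s = θ² / n`. -/
def spikeSecondMoment {n : ℕ} (s : ℝ) (y : Fin n → ℝ) : ℝ :=
  ∏ i, ((√(1 + 2 * s))⁻¹ * Real.exp (2 * s * y i ^ 2 / (1 + 2 * s)))

theorem spikeMean_pos {n : ℕ} {s : ℝ} (hs : 0 ≤ s) (y : Fin n → ℝ) : 0 < spikeMean s y :=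
  Finset.prod_pos fun _ _ => by positivity

theorem spikeSecondMoment_pos {n : ℕ} {s : ℝ} (hs : 0 ≤ s) (y : Fin n → ℝ) :
    0 < spikeSecondMoment s y :=
  Finset.prod_pos fun _ _ => by positivity

theorem lintegral_pi_exp_quadratic {n : ℕ} {v : ℝ≥0} (hv : v ≠ 0) (b : Fin n → ℝ) (c : ℝ)
    (hc : 0 < 1 + 2 * c * v) :
    ∫⁻ x, ENNReal.ofReal (Real.exp (∑ i, (b i * x i - c * x i ^ 2)))
        ∂Measure.pi (fun _ : Fin n => gaussianReal 0 v) =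
      ENNReal.ofReal (∏ i, ((√(1 + 2 * c * v))⁻¹ *
        Real.exp (b i ^ 2 * v / (2 * (1 + 2 * c * v))))) := by
  simp_rw [Real.exp_sum, ENNReal.ofReal_prod_of_nonneg (fun i _ => (Real.exp_pos _).le)]
  rw [lintegral_pi_prod_eval _ Finset.univ
    (fun i t => ENNReal.ofReal (Real.exp (b i * t - c * t ^ 2))) (fun i => by fun_prop),
    ENNReal.ofReal_prod_of_nonneg fun i _ => by positivity]
  exact Finset.prod_congr rfl fun i _ => lintegral_exp_quadratic_gaussianReal hv _ _ hc

theorem lintegral_spikeLik {n : ℕ} (hn : 0 < n) (θ : ℝ) (y : Fin n → ℝ) :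
    ∫⁻ x, ENNReal.ofReal (spikeLik θ x y)
        ∂Measure.pi (fun _ : Fin n => gaussianReal 0 (n : ℝ≥0)⁻¹) =
      ENNReal.ofReal (spikeMean (θ ^ 2 / n) y) := by
  have hn' : (0 : ℝ) < n := by exact_mod_cast hn
  have hv : (n : ℝ≥0)⁻¹ ≠ 0 := by positivity
  unfold spikeLik spikeMean
  rw [lintegral_pi_exp_quadratic hv (fun i => θ * y i) (θ ^ 2 / 2) (by positivity)]
  have h : 1 + 2 * (θ ^ 2 / 2) * (((n : ℝ≥0)⁻¹ : ℝ≥0) : ℝ) = 1 + θ ^ 2 / n := by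
    push_cast; ring
  rw [h]
  congr 2
  ext i
  congr 3
  push_cast
  ring

theorem lintegral_spikeLik_sq {n : ℕ} (hn : 0 < n) (θ : ℝ) (y : Fin n → ℝ) :
    ∫⁻ x, ENNReal.ofReal (spikeLik θ x y ^ 2)
        ∂Measure.pi (fun _ : Fin n => gaussianReal 0 (n : ℝ≥0)⁻¹) =
      ENNReal.ofReal (spikeSecondMoment (θ ^ 2 / n) y) := by
  have hn' : (0 : ℝ) < n := by exact_mod_cast hn
  have hv : (n : ℝ≥0)⁻¹ ≠ 0 := by positivity
  have hsq : ∀ x : Fin n → ℝ, spikeLik θ x y ^ 2 =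
      Real.exp (∑ i, (2 * θ * y i * x i - θ ^ 2 * x i ^ 2)) := by
    intro x
    rw [spikeLik, ← Real.exp_nat_mul, Finset.mul_sum]
    congr 2
    ext i
    push_cast
    ring
  simp_rw [hsq]
  unfold spikeSecondMoment
  rw [lintegral_pi_exp_quadratic hv (fun i => 2 * θ * y i) (θ ^ 2) (by positivity)]
  have h : 1 + 2 * (θ ^ 2) * (((n : ℝ≥0)⁻¹ : ℝ≥0) : ℝ) = 1 + 2 * (θ ^ 2 / n) := by
    push_cast; ring
  rw [h]
  congr 2
  ext i
  congr 2
  push_cast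
  field_simp

theorem lintegral_pi_gaussian_prod_exp {n : ℕ} (A c : ℝ) (hA : 0 ≤ A) (hc : 0 < 1 + 2 * c) :
    ∫⁻ y, ENNReal.ofReal (∏ i, (A * Real.exp (-(c * y i ^ 2))))
        ∂Measure.pi (fun _ : Fin n => gaussianReal 0 1) =
      ENNReal.ofReal ((A / √(1 + 2 * c)) ^ n) := by
  have h1 : ∀ y : Fin n → ℝ, ENNReal.ofReal (∏ i, (A * Real.exp (-(c * y i ^ 2)))) =
      ENNReal.ofReal (A ^ n) *
        ENNReal.ofReal (Real.exp (∑ i, ((fun _ : Fin n => (0 : ℝ)) i * y i - c * y i ^ 2))) := by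
    intro y
    rw [Finset.prod_mul_distrib, Finset.prod_const, Finset.card_univ, Fintype.card_fin,
      ← Real.exp_sum, ENNReal.ofReal_mul (by positivity)]
    simp
  simp_rw [h1]
  rw [lintegral_const_mul' _ _ ENNReal.ofReal_ne_top,
    lintegral_pi_exp_quadratic one_ne_zero _ _ (by simpa using hc),
    ← ENNReal.ofReal_mul (by positivity)]
  congr 1
  simp [div_eq_mul_inv, mul_pow]

theorem lintegral_secondMoment_div_mean {n : ℕ} {s : ℝ} (hs : 0 ≤ s) :
    ∫⁻ y, ENNReal.ofReal (spikeSecondMoment s y / spikeMean s y)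
        ∂Measure.pi (fun _ : Fin n => gaussianReal 0 1) = ENNReal.ofReal ((1 + s) ^ n) := by
  have h1 : 0 < 1 + s := by linarith
  have h2 : 0 < 1 + 2 * s := by linarith
  set c : ℝ := s / (2 * (1 + s)) - 2 * s / (1 + 2 * s) with hc
  have hc' : 1 + 2 * c = ((1 + 2 * s) * (1 + s))⁻¹ := by rw [hc]; field_simp; ring
  have h : ∀ y : Fin n → ℝ, spikeSecondMoment s y / spikeMean s y =
      ∏ i, (√(1 + s) / √(1 + 2 * s) * Real.exp (-(c * y i ^ 2))) := by
    intro y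
    rw [spikeSecondMoment, spikeMean, ← Finset.prod_div_distrib]
    refine Finset.prod_congr rfl fun i _ => ?_
    have : -(c * y i ^ 2) = 2 * s * y i ^ 2 / (1 + 2 * s) - s * y i ^ 2 / (2 * (1 + s)) := by
      rw [hc]; ring
    rw [this, Real.exp_sub]
    field_simp
  simp_rw [h]
  rw [lintegral_pi_gaussian_prod_exp _ _ (by positivity) (by rw [hc']; positivity), hc',
    Real.sqrt_inv, Real.sqrt_mul h2.le]
  congr 2
  have := Real.mul_self_sqrt h1.le
  field_simp
  linarith

theorem lintegral_secondMoment_sq_div_mean_cube {n : ℕ} {s : ℝ} (hs : 0 ≤ s) (hs2 : 2 * s < 1) :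
    ∫⁻ y, ENNReal.ofReal (spikeSecondMoment s y ^ 2 / spikeMean s y ^ 3)
        ∂Measure.pi (fun _ : Fin n => gaussianReal 0 1) =
      ENNReal.ofReal (((1 + s) ^ 2 / √(1 - 4 * s ^ 2)) ^ n) := by
  have h1 : 0 < 1 + s := by linarith
  have h2 : 0 < 1 + 2 * s := by linarith
  have h3 : 0 < 1 - 2 * s := by linarith
  set c : ℝ := 3 * (s / (2 * (1 + s))) - 2 * (2 * s / (1 + 2 * s)) with hc
  have hc' : 1 + 2 * c = (1 - 2 * s) / ((1 + 2 * s) * (1 + s)) := by rw [hc]; field_simp; ring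
  have h : ∀ y : Fin n → ℝ, spikeSecondMoment s y ^ 2 / spikeMean s y ^ 3 =
      ∏ i, (√(1 + s) ^ 3 / √(1 + 2 * s) ^ 2 * Real.exp (-(c * y i ^ 2))) := by
    intro y
    rw [spikeSecondMoment, spikeMean, ← Finset.prod_pow, ← Finset.prod_pow,
      ← Finset.prod_div_distrib]
    refine Finset.prod_congr rfl fun i _ => ?_
    have : -(c * y i ^ 2) = (2 : ℕ) * (2 * s * y i ^ 2 / (1 + 2 * s)) -
        (3 : ℕ) * (s * y i ^ 2 / (2 * (1 + s))) := by
      rw [hc]; push_cast; ring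
    rw [this, Real.exp_sub, Real.exp_nat_mul, Real.exp_nat_mul]
    field_simp
  simp_rw [h]
  have h4 : 1 - 4 * s ^ 2 = (1 - 2 * s) * (1 + 2 * s) := by ring
  rw [lintegral_pi_gaussian_prod_exp _ _ (by positivity) (by rw [hc']; positivity), hc',
    Real.sqrt_div h3.le, Real.sqrt_mul h2.le, h4, Real.sqrt_mul h3.le]
  congr 2
  have e1 := Real.sq_sqrt h1.le
  have e2 := Real.sq_sqrt h2.le
  have hp3 := Real.sqrt_pos.mpr h3
  have hp2 := Real.sqrt_pos.mpr h2
  have e4 : √(1 + s) ^ 4 = (1 + s) ^ 2 := by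
    rw [show (4 : ℕ) = 2 * 2 from rfl, pow_mul, e1]
  field_simp
  rw [e4]

/-- The average of the likelihood ratios at the spike sizes `θ` and `-θ`. -/
def spikeAvgLik {n : ℕ} (θ : ℝ) (x y : Fin n → ℝ) : ℝ :=
  (spikeLik θ x y + spikeLik (-θ) x y) / 2

theorem spikeAvgLik_pos {n : ℕ} (θ : ℝ) (x y : Fin n → ℝ) : 0 < spikeAvgLik θ x y := by
  have := spikeLik_pos θ x y
  have := spikeLik_pos (-θ) x y
  unfold spikeAvgLik
  positivity

theorem spikeAvgLik_neg {n : ℕ} (θ : ℝ) (x y : Fin n → ℝ) :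
    spikeAvgLik (-θ) x y = spikeAvgLik θ x y := by
  unfold spikeAvgLik
  rw [neg_neg, add_comm]

@[fun_prop]
theorem measurable_spikeAvgLik {n : ℕ} {α : Type*} [MeasurableSpace α] (θ : ℝ)
    {f g : α → Fin n → ℝ} (hf : Measurable f) (hg : Measurable g) :
    Measurable fun a => spikeAvgLik θ (f a) (g a) := by
  unfold spikeAvgLik
  fun_prop

theorem lintegral_exp_neg_mul_spikeAvgLik_le {n : ℕ} (hn : 0 < n) (θ : ℝ) (y : Fin n → ℝ) {l : ℝ}
    (hl : 0 ≤ l) :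
    ∫⁻ x, ENNReal.ofReal (Real.exp (-(l * spikeAvgLik θ x y)))
        ∂Measure.pi (fun _ : Fin n => gaussianReal 0 (n : ℝ≥0)⁻¹) ≤
      ENNReal.ofReal (Real.exp (-(l * spikeMean (θ ^ 2 / n) y) +
        l ^ 2 * spikeSecondMoment (θ ^ 2 / n) y / 2)) := by
  have hs : 0 ≤ θ ^ 2 / n := by positivity
  have hM := spikeMean_pos hs y
  have hG := spikeSecondMoment_pos hs y
  have hhalf : ∀ A : ℝ, 0 ≤ A → ENNReal.ofReal (1 / 2) * ENNReal.ofReal A +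
      ENNReal.ofReal (1 / 2) * ENNReal.ofReal A = ENNReal.ofReal A := by
    intro A hA
    rw [← ENNReal.ofReal_mul (by norm_num), ← ENNReal.ofReal_add (by positivity) (by positivity)]
    congr 1
    ring
  refine lintegral_exp_neg_mul_le _ (by fun_prop) (fun x => (spikeAvgLik_pos θ x y).le)
    hM.le hG.le hl ?_ ?_
  · have h : ∀ x, ENNReal.ofReal (spikeAvgLik θ x y) =
        ENNReal.ofReal (1 / 2) * ENNReal.ofReal (spikeLik θ x y) +
          ENNReal.ofReal (1 / 2) * ENNReal.ofReal (spikeLik (-θ) x y) := by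
      intro x
      have h1 := (spikeLik_pos θ x y).le
      have h2 := (spikeLik_pos (-θ) x y).le
      rw [← ENNReal.ofReal_mul (by norm_num), ← ENNReal.ofReal_mul (by norm_num),
        ← ENNReal.ofReal_add (by positivity) (by positivity), spikeAvgLik]
      congr 1
      ring
    simp_rw [h]
    rw [lintegral_add_left (by fun_prop), lintegral_const_mul' _ _ ENNReal.ofReal_ne_top,
      lintegral_const_mul' _ _ ENNReal.ofReal_ne_top, lintegral_spikeLik hn, lintegral_spikeLik hn,
      neg_sq, hhalf _ hM.le]
  · have h : ∀ x, ENNReal.ofReal (spikeAvgLik θ x y ^ 2) ≤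
        ENNReal.ofReal (1 / 2) * ENNReal.ofReal (spikeLik θ x y ^ 2) +
          ENNReal.ofReal (1 / 2) * ENNReal.ofReal (spikeLik (-θ) x y ^ 2) := by
      intro x
      rw [← ENNReal.ofReal_mul (by norm_num), ← ENNReal.ofReal_mul (by norm_num),
        ← ENNReal.ofReal_add (by positivity) (by positivity), spikeAvgLik]
      apply ENNReal.ofReal_le_ofReal
      nlinarith [sq_nonneg (spikeLik θ x y - spikeLik (-θ) x y)]
    refine (lintegral_mono h).trans_eq ?_
    rw [lintegral_add_left (by fun_prop), lintegral_const_mul' _ _ ENNReal.ofReal_ne_top,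
      lintegral_const_mul' _ _ ENNReal.ofReal_ne_top, lintegral_spikeLik_sq hn,
      lintegral_spikeLik_sq hn, neg_sq, hhalf _ hG.le]

theorem sq_div_le_add_exp {a S T θ l q : ℝ} (ha : 0 < a) (hS : 0 < S) (hq : 0 < q) (hl : 0 ≤ l)
    (hT : T + a / q ≤ S) (hT0 : 0 ≤ T) (hθ : 0 < θ) :
    a ^ 2 / S ≤ a ^ 2 / θ + q * (a * Real.exp (l * (θ - T))) := by
  rcases le_total θ T with h | h
  · have h1 : a ^ 2 / S ≤ a ^ 2 / θ := by
      have : 0 < a / q := by positivity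
      gcongr
      linarith
    have : 0 ≤ q * (a * Real.exp (l * (θ - T))) := by positivity
    linarith
  · have h1 : a ^ 2 / S ≤ q * a := by
      rw [div_le_iff₀ hS]
      have : a / q ≤ S := by linarith
      calc a ^ 2 = q * a * (a / q) := by field_simp
        _ ≤ q * a * S := by gcongr
    have h2 : 1 ≤ Real.exp (l * (θ - T)) :=
      Real.one_le_exp (mul_nonneg hl (by linarith))
    have h3 : q * (a * 1) ≤ q * (a * Real.exp (l * (θ - T))) := by gcongr
    have h4 : 0 ≤ a ^ 2 / θ := by positivity
    linarith

theorem lintegral_spikeLik_sq_div_le {n m : ℕ} (hn : 0 < n) {δ : ℝ} (hδ : 0 < δ) (hδ1 : δ < 1)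
    (hm : (1 - δ / 2) * m ≤ m - 1) (θ : ℝ) (j : Fin m) (y : Fin n → ℝ) :
    ∫⁻ X, ENNReal.ofReal (spikeLik θ (X j) y ^ 2 / ((∑ k, spikeAvgLik θ (X k) y) / m))
        ∂Measure.pi (fun _ : Fin m =>
          Measure.pi (fun _ : Fin n => gaussianReal 0 (n : ℝ≥0)⁻¹)) ≤
      ENNReal.ofReal ((1 - δ)⁻¹) * ENNReal.ofReal
        (spikeSecondMoment (θ ^ 2 / n) y / spikeMean (θ ^ 2 / n) y) +
      ENNReal.ofReal (256 / (δ ^ 4 * m)) * ENNReal.ofReal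
        (spikeSecondMoment (θ ^ 2 / n) y ^ 2 / spikeMean (θ ^ 2 / n) y ^ 3) := by
  have hs : 0 ≤ θ ^ 2 / n := by positivity
  have hm0 : 0 < m := j.pos
  have hmR : (0 : ℝ) < m := by exact_mod_cast hm0
  have hδ' : 0 < 1 - δ := by linarith
  set h := spikeMean (θ ^ 2 / n) y with hh
  set g := spikeSecondMoment (θ ^ 2 / n) y with hg
  have hpos : 0 < h := spikeMean_pos hs y
  have gpos : 0 < g := spikeSecondMoment_pos hs y
  set ν := Measure.pi (fun _ : Fin n => gaussianReal 0 (n : ℝ≥0)⁻¹) with hν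
  set l : ℝ := δ * h / (2 * g) with hl
  have lpos : 0 < l := by positivity
  let F : Fin m → (Fin n → ℝ) → ℝ≥0∞ := fun k x =>
    if k = j then ENNReal.ofReal (spikeLik θ x y)
    else ENNReal.ofReal (Real.exp (-(l * spikeAvgLik θ x y)))
  have hF : ∀ k, Measurable (F k) := by
    intro k
    by_cases hk : k = j <;> simp only [F, hk, if_true, if_false] <;> fun_prop
  have hpt : ∀ X : Fin m → Fin n → ℝ,
      ENNReal.ofReal (spikeLik θ (X j) y ^ 2 / ((∑ k, spikeAvgLik θ (X k) y) / m)) ≤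
        ENNReal.ofReal (((1 - δ) * h)⁻¹) * ENNReal.ofReal (spikeLik θ (X j) y ^ 2) +
        ENNReal.ofReal (2 * m * Real.exp (l * ((1 - δ) * m * h))) * ∏ k, F k (X k) := by
    intro X
    have hprod : ∏ k, F k (X k) = ENNReal.ofReal (spikeLik θ (X j) y *
        Real.exp (-(l * ∑ k ∈ Finset.univ.erase j, spikeAvgLik θ (X k) y))) := by
      rw [← Finset.mul_prod_erase _ _ (Finset.mem_univ j), ENNReal.ofReal_mul (spikeLik_pos _ _ _).le,
        Finset.mul_sum, ← Finset.sum_neg_distrib, Real.exp_sum,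
        ENNReal.ofReal_prod_of_nonneg fun i _ => (Real.exp_pos _).le]
      congr 1
      · simp [F]
      · refine Finset.prod_congr rfl fun k hk => ?_
        simp [F, Finset.ne_of_mem_erase hk]
    have ha := spikeLik_pos θ (X j) y
    rw [hprod, ← ENNReal.ofReal_mul (by positivity), ← ENNReal.ofReal_mul (by positivity),
      ← ENNReal.ofReal_add (by positivity) (by positivity)]
    apply ENNReal.ofReal_le_ofReal
    set T := ∑ k ∈ Finset.univ.erase j, spikeAvgLik θ (X k) y with hT
    have hT0 : 0 ≤ T := Finset.sum_nonneg fun k _ => (spikeAvgLik_pos _ _ _).le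
    have hsum : ∑ k, spikeAvgLik θ (X k) y = spikeAvgLik θ (X j) y + T :=
      (Finset.add_sum_erase _ _ (Finset.mem_univ j)).symm
    have hW : spikeLik θ (X j) y / 2 ≤ spikeAvgLik θ (X j) y := by
      have := spikeLik_pos (-θ) (X j) y
      unfold spikeAvgLik
      linarith
    have key := sq_div_le_add_exp (a := spikeLik θ (X j) y)
      (S := (∑ k, spikeAvgLik θ (X k) y) / m) (T := T / m) (θ := (1 - δ) * h) (l := l * m)
      (q := 2 * m) ha
      (by rw [hsum]; have := spikeAvgLik_pos θ (X j) y; positivity)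
      (by positivity) (by positivity)
      (by rw [hsum, ← div_div, ← add_div]; gcongr ?_ / _; linarith) (by positivity) (by positivity)
    refine key.trans_eq ?_
    have he : l * m * ((1 - δ) * h - T / m) = l * ((1 - δ) * m * h) + -(l * T) := by
      field_simp
      ring
    rw [he, Real.exp_add]
    ring
  refine (lintegral_mono hpt).trans ?_
  rw [lintegral_add_left (by fun_prop), lintegral_const_mul' _ _ ENNReal.ofReal_ne_top,
    lintegral_const_mul' _ _ ENNReal.ofReal_ne_top,
    lintegral_pi_prod_eval (fun _ : Fin m => ν) Finset.univ F hF]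
  have hfirst : ∫⁻ X : Fin m → Fin n → ℝ, ENNReal.ofReal (spikeLik θ (X j) y ^ 2)
      ∂Measure.pi (fun _ : Fin m => ν) = ENNReal.ofReal g := by
    rw [(measurePreserving_eval (fun _ : Fin m => ν) j).lintegral_comp
      (f := fun x => ENNReal.ofReal (spikeLik θ x y ^ 2)) (by fun_prop)]
    exact lintegral_spikeLik_sq hn θ y
  rw [hfirst]
  gcongr ?_ + ?_
  · rw [← ENNReal.ofReal_mul (by positivity), ← ENNReal.ofReal_mul (by positivity)]
    apply le_of_eq
    congr 1
    field_simp
  · set E : ℝ := -(l * h) + l ^ 2 * g / 2 with hE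
    have hprod : ∏ k, ∫⁻ x, F k x ∂ν ≤ ENNReal.ofReal (h * Real.exp (E * (m - 1 : ℕ))) := by
      rw [← Finset.mul_prod_erase _ _ (Finset.mem_univ j), ENNReal.ofReal_mul hpos.le]
      gcongr
      · apply le_of_eq
        simp only [F, if_true]
        exact lintegral_spikeLik hn θ y
      · calc _ ≤ ∏ _k ∈ Finset.univ.erase j, ENNReal.ofReal (Real.exp E) := by
              refine Finset.prod_le_prod' fun k hk => ?_
              simp only [F, Finset.ne_of_mem_erase hk, if_false]
              exact lintegral_exp_neg_mul_spikeAvgLik_le hn θ y lpos.le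
          _ = _ := by
              rw [Finset.prod_const, Finset.card_erase_of_mem (Finset.mem_univ j),
                Finset.card_univ, Fintype.card_fin, ← ENNReal.ofReal_pow (Real.exp_pos _).le,
                ← Real.exp_nat_mul, mul_comm]
    refine (mul_le_mul_right hprod _).trans ?_
    rw [← ENNReal.ofReal_mul (by positivity), ← ENNReal.ofReal_mul (by positivity)]
    apply ENNReal.ofReal_le_ofReal
    set x : ℝ := δ ^ 2 * m * h ^ 2 / (8 * g) with hx
    have hexp : l * ((1 - δ) * m * h) + E * (m - 1 : ℕ) ≤ -x := by
      have hE' : E = -(δ * h ^ 2 / (2 * g)) + δ ^ 2 * h ^ 2 / (8 * g) := by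
        rw [hE, hl]; field_simp; ring
      have hcast : ((m - 1 : ℕ) : ℝ) = m - 1 := by
        rw [Nat.cast_sub hm0]; simp
      have hu : 0 < h ^ 2 / g := by positivity
      have e1 : l * ((1 - δ) * m * h) + E * (m - 1 : ℕ) =
          h ^ 2 / g * (δ / 2 * ((1 - δ) * m - (m - 1)) + δ ^ 2 / 8 * (m - 1)) := by
        rw [hE', hl, hcast]; field_simp; ring
      have e2 : -x = h ^ 2 / g * (-(δ ^ 2 * m / 8)) := by
        rw [hx]; field_simp
      rw [e1, e2]
      refine mul_le_mul_of_nonneg_left ?_ hu.le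
      nlinarith [mul_le_mul_of_nonneg_left hm hδ.le, sq_nonneg δ]
    have hx0 : 0 < x := by positivity
    calc 2 * m * Real.exp (l * ((1 - δ) * m * h)) * (h * Real.exp (E * (m - 1 : ℕ)))
        = 2 * m * h * Real.exp (l * ((1 - δ) * m * h) + E * (m - 1 : ℕ)) := by
          rw [Real.exp_add]; ring
      _ ≤ 2 * m * h * Real.exp (-x) := by gcongr
      _ ≤ 2 * m * h * (2 / x ^ 2) := by
          gcongr
          exact exp_neg_le_two_div_sq hx0
      _ = _ := by rw [hx]; field_simp; norm_num

theorem lintegral_prod_spikeLik_sq_div_le {n m : ℕ} (hn : 0 < n) {δ : ℝ} (hδ : 0 < δ)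
    (hδ1 : δ < 1) (hm : (1 - δ / 2) * m ≤ m - 1) (θ : ℝ) (hθ : 2 * (θ ^ 2 / n) < 1) (j : Fin m) :
    ∫⁻ p, ENNReal.ofReal
        (spikeLik θ (p.1 j) p.2 ^ 2 / ((∑ k, spikeAvgLik θ (p.1 k) p.2) / m))
        ∂(Measure.pi (fun _ : Fin m =>
          Measure.pi (fun _ : Fin n => gaussianReal 0 (n : ℝ≥0)⁻¹))).prod
          (Measure.pi fun _ : Fin n => gaussianReal 0 1) ≤
      ENNReal.ofReal ((1 - δ)⁻¹ * (1 + θ ^ 2 / n) ^ n + 256 / (δ ^ 4 * m) *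
        ((1 + θ ^ 2 / n) ^ 2 / √(1 - 4 * (θ ^ 2 / n) ^ 2)) ^ n) := by
  have hs : 0 ≤ θ ^ 2 / n := by positivity
  have hδ' : 0 < 1 - δ := by linarith
  rw [lintegral_prod_symm' _ (by fun_prop)]
  refine (lintegral_mono fun y => lintegral_spikeLik_sq_div_le hn hδ hδ1 hm θ j y).trans ?_
  have hmeas : Measurable fun y : Fin n → ℝ =>
      ENNReal.ofReal (spikeSecondMoment (θ ^ 2 / n) y / spikeMean (θ ^ 2 / n) y) := by
    unfold spikeSecondMoment spikeMean
    fun_prop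
  rw [lintegral_add_left (hmeas.const_mul _), lintegral_const_mul' _ _ ENNReal.ofReal_ne_top,
    lintegral_const_mul' _ _ ENNReal.ofReal_ne_top, lintegral_secondMoment_div_mean hs,
    lintegral_secondMoment_sq_div_mean_cube hs hθ, ← ENNReal.ofReal_mul (by positivity),
    ← ENNReal.ofReal_mul (by positivity), ← ENNReal.ofReal_add (by positivity) (by positivity)]

theorem measurable_pmData (n m : ℕ) (mu : ℝ) : Measurable (pmData n m mu) := by
  unfold pmData
  refine measurable_fst.fst.prodMk (measurable_pi_lambda _ fun i => ?_)
  refine Measurable.add (Finset.measurable_fun_sum _ fun j _ => ?_) (by fun_prop)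
  exact Measurable.mul (by fun_prop)
    ((measurable_of_countable fun q : Fin m × Bool => pmSignal m mu q j).comp measurable_snd)

/-- The design and noise distribution, which is the law of the data when there is no spike. -/
def pmNull (n m : ℕ) : Measure ((Fin n → Fin m → ℝ) × (Fin n → ℝ)) :=
  (Measure.pi fun _ : Fin n => Measure.pi fun _ : Fin m => gaussianReal 0 (n : ℝ≥0)⁻¹).prod
    (Measure.pi fun _ : Fin n => gaussianReal 0 1)

theorem lintegral_pmLaw {n m : ℕ} (hm : 0 < m) (mu : ℝ)
    (F : Fin m × Bool → (Fin n → Fin m → ℝ) × (Fin n → ℝ) → ℝ≥0∞)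
    (hF : ∀ q, Measurable (F q)) :
    ∫⁻ ω, F ω.2 (pmData n m mu ω) ∂pmLaw n m =
      ∫⁻ p, ∑ k, (ENNReal.ofReal (2 * m)⁻¹ *
        (ENNReal.ofReal (spikeLik mu (fun i => p.1 i k) p.2) * F (k, true) p +
         ENNReal.ofReal (spikeLik (-mu) (fun i => p.1 i k) p.2) * F (k, false) p)) ∂pmNull n m := by
  have hshift : ∀ q : Fin m × Bool, ∫⁻ p, F q (pmData n m mu (p, q)) ∂pmNull n m =
      ∫⁻ p, ENNReal.ofReal (spikeLik (if q.2 then mu else -mu) (fun i => p.1 i q.1) p.2) * F q p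
        ∂pmNull n m := by
    intro q
    set θ := if q.2 then mu else -mu with hθ
    have hdata : ∀ p, pmData n m mu (p, q) = (p.1, fun i => θ * p.1 i q.1 + p.2 i) := by
      intro p
      simp only [pmData, pmSignal, ← hθ]
      congr 1
      ext i
      simp [mul_comm]
    simp_rw [hdata]
    have hFq := hF q
    rw [pmNull, lintegral_prod _ (by fun_prop), lintegral_prod _ (by fun_prop)]
    refine lintegral_congr fun X => ?_
    refine (lintegral_gaussian_shift (fun i => θ * X i q.1) (fun z => F q (X, z))
      (by fun_prop)).trans ?_
    refine lintegral_congr fun z => ?_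
    simp only [spikeLik]
    congr 4
    ext i
    ring
  have hweight : ∀ q : Fin m × Bool,
      ((((m : ℝ≥0∞))⁻¹ • Measure.count).prod (((2 : ℝ≥0∞))⁻¹ • Measure.count)) {q} =
        ENNReal.ofReal (2 * m)⁻¹ := by
    rintro ⟨k, b⟩
    have hfin : IsFiniteMeasure ((m : ℝ≥0∞)⁻¹ • (Measure.count : Measure (Fin m))) :=
      Measure.smul_finite _ (by simpa using hm.ne')
    have hfin2 : IsFiniteMeasure ((2 : ℝ≥0∞)⁻¹ • (Measure.count : Measure Bool)) :=
      Measure.smul_finite _ (by simp)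
    rw [← Set.singleton_prod_singleton, Measure.prod_prod]
    simp only [Measure.smul_apply, Measure.count_singleton, smul_eq_mul, mul_one]
    rw [mul_inv, ENNReal.ofReal_mul (by positivity), ENNReal.ofReal_inv_of_pos (by norm_num),
      ENNReal.ofReal_inv_of_pos (by exact_mod_cast hm), mul_comm]
    simp
  have hmeas : Measurable fun ω : PMOmega n m => F ω.2 (pmData n m mu ω) := by
    have h : Measurable fun r : ((Fin n → Fin m → ℝ) × (Fin n → ℝ)) × (Fin m × Bool) => F r.2 r.1 :=
      measurable_from_prod_countable_left fun q => hF q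
    exact h.comp ((measurable_pmData n m mu).prodMk measurable_snd)
  have hfin : SFinite ((((m : ℝ≥0∞))⁻¹ • (Measure.count : Measure (Fin m))).prod
      (((2 : ℝ≥0∞))⁻¹ • (Measure.count : Measure Bool))) := inferInstance
  have hlaw : pmLaw n m = (pmNull n m).prod ((((m : ℝ≥0∞))⁻¹ • Measure.count).prod
      (((2 : ℝ≥0∞))⁻¹ • Measure.count)) := rfl
  have hnull : SFinite (pmNull n m) := by unfold pmNull; infer_instance
  rw [hlaw, lintegral_prod_symm' _ hmeas, lintegral_fintype]
  simp_rw [hweight, hshift]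
  rw [Fintype.sum_prod_type, lintegral_finsetSum]
  · refine Finset.sum_congr rfl fun k _ => ?_
    have h1 := hF (k, true)
    have h2 := hF (k, false)
    rw [lintegral_const_mul' _ _ ENNReal.ofReal_ne_top, lintegral_add_left (by fun_prop)]
    simp [mul_comm, mul_add]
  · intro k _
    have h1 := hF (k, true)
    have h2 := hF (k, false)
    fun_prop

theorem posterior_loss_lower_bound {m : ℕ} (hm : 0 < m) (mu : ℝ) (a b e : Fin m → ℝ)
    (ha : ∀ k, 0 < a k) (hb : ∀ k, 0 < b k) :
    ∑ k, (2 * m : ℝ)⁻¹ * (a k * mu ^ 2 + b k * mu ^ 2) ≤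
      ∑ k, (2 * m : ℝ)⁻¹ * (a k * ∑ j, (e j - if j = k then mu else 0) ^ 2 +
        b k * ∑ j, (e j - if j = k then -mu else 0) ^ 2) +
      mu ^ 2 / (4 * m ^ 2) * ∑ k, (a k ^ 2 / ((∑ i, (a i + b i) / 2) / m) +
        b k ^ 2 / ((∑ i, (a i + b i) / 2) / m)) := by
  have hmR : (0 : ℝ) < m := by exact_mod_cast hm
  have hne : (Finset.univ : Finset (Fin m)).Nonempty := ⟨⟨0, hm⟩, Finset.mem_univ _⟩
  set Z : ℝ := (∑ i, (a i + b i) / 2) / m with hZ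
  have hZ0 : 0 < Z := by
    have : 0 < ∑ i, (a i + b i) / 2 :=
      Finset.sum_pos (fun i _ => by have := ha i; have := hb i; positivity) hne
    positivity
  have hsq : ∀ (t : ℝ) (k : Fin m), ∑ j, (e j - if j = k then t else 0) ^ 2 =
      ∑ j, e j ^ 2 - 2 * t * e k + t ^ 2 := by
    intro t k
    have : ∀ j, (e j - if j = k then t else 0) ^ 2 =
        e j ^ 2 - (if j = k then 2 * t * e k else 0) + (if j = k then t ^ 2 else 0) := by
      intro j
      by_cases h : j = k
      · simp [h]; ring
      · simp [h]
    simp_rw [this, Finset.sum_add_distrib, Finset.sum_sub_distrib]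
    simp
  simp_rw [hsq]
  set N : ℝ := ∑ j, e j ^ 2 with hN
  have hZN : Z * N = ∑ k, (2 * m : ℝ)⁻¹ * (a k * N + b k * N) := by
    rw [hZ, Finset.sum_div, Finset.sum_mul]
    refine Finset.sum_congr rfl fun k _ => ?_
    field_simp
  have hNZ : ∑ k, Z * e k ^ 2 = ∑ k, (2 * m : ℝ)⁻¹ * (a k * N + b k * N) := by
    rw [← hZN, hN, Finset.mul_sum]
  have hterm : ∀ k, 0 ≤ Z * e k ^ 2 - mu / m * e k * (a k - b k) +
      mu ^ 2 / (4 * m ^ 2) * (a k ^ 2 / Z + b k ^ 2 / Z) := by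
    intro k
    have h1 : 0 ≤ Z * (e k - mu * (a k - b k) / (2 * m * Z)) ^ 2 := by positivity
    have h2 : 0 ≤ mu ^ 2 / (4 * m ^ 2) * (2 * a k * b k / Z) := by
      have := ha k; have := hb k; positivity
    have h3 : Z * (e k - mu * (a k - b k) / (2 * m * Z)) ^ 2 +
        mu ^ 2 / (4 * m ^ 2) * (2 * a k * b k / Z) = Z * e k ^ 2 - mu / m * e k * (a k - b k) +
        mu ^ 2 / (4 * m ^ 2) * (a k ^ 2 / Z + b k ^ 2 / Z) := by
      field_simp
      ring
    linarith
  have hsum := Finset.sum_nonneg (s := Finset.univ) fun k _ => hterm k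
  rw [Finset.sum_add_distrib, Finset.sum_sub_distrib, hNZ, ← Finset.sum_sub_distrib,
    ← Finset.mul_sum] at hsum
  have hfin : ∑ k, (2 * m : ℝ)⁻¹ * (a k * (N - 2 * mu * e k + mu ^ 2) +
      b k * (N - 2 * -mu * e k + (-mu) ^ 2)) =
      ∑ k, ((2 * m : ℝ)⁻¹ * (a k * N + b k * N) - mu / m * e k * (a k - b k)) +
      ∑ k, (2 * m : ℝ)⁻¹ * (a k * mu ^ 2 + b k * mu ^ 2) := by
    rw [← Finset.sum_add_distrib]
    refine Finset.sum_congr rfl fun k _ => ?_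
    field_simp
    ring
  rw [hfin]
  linarith

theorem isProbabilityMeasure_pmLaw (n : ℕ) {m : ℕ} (hm : 0 < m) :
    IsProbabilityMeasure (pmLaw n m) := by
  have h1 : IsProbabilityMeasure ((m : ℝ≥0∞)⁻¹ • (Measure.count : Measure (Fin m))) :=
    ⟨by simpa using ENNReal.inv_mul_cancel (by simpa using hm.ne') (by simp)⟩
  have h2 : IsProbabilityMeasure ((2 : ℝ≥0∞)⁻¹ • (Measure.count : Measure Bool)) :=
    ⟨by
      rw [Measure.smul_apply, smul_eq_mul, Measure.count_univ, ENat.card_eq_coe_fintype_card,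
        Fintype.card_bool]
      simpa using ENNReal.inv_mul_cancel (a := 2) (by simp) (by simp)⟩
  unfold pmLaw
  infer_instance

theorem lintegral_pmNull_spikeLik_sq_div_le {n m : ℕ} (hn : 0 < n) {δ : ℝ} (hδ : 0 < δ)
    (hδ1 : δ < 1) (hm : (1 - δ / 2) * m ≤ m - 1) (θ : ℝ) (hθ : 2 * (θ ^ 2 / n) < 1) (j : Fin m) :
    ∫⁻ p, ENNReal.ofReal (spikeLik θ (fun i => p.1 i j) p.2 ^ 2 /
        ((∑ k, spikeAvgLik θ (fun i => p.1 i k) p.2) / m)) ∂pmNull n m ≤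
      ENNReal.ofReal ((1 - δ)⁻¹ * (1 + θ ^ 2 / n) ^ n + 256 / (δ ^ 4 * m) *
        ((1 + θ ^ 2 / n) ^ 2 / √(1 - 4 * (θ ^ 2 / n) ^ 2)) ^ n) := by
  refine le_trans (le_of_eq ?_) (lintegral_prod_spikeLik_sq_div_le hn hδ hδ1 hm θ hθ j)
  have hswap := (measurePreserving_swap_pi (ι := Fin n) (κ := Fin m)
    (gaussianReal 0 (n : ℝ≥0)⁻¹)).prod
    (MeasurePreserving.id (Measure.pi fun _ : Fin n => gaussianReal 0 1))
  exact hswap.lintegral_comp (f := fun p : (Fin m → Fin n → ℝ) × (Fin n → ℝ) =>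
    ENNReal.ofReal (spikeLik θ (p.1 j) p.2 ^ 2 / ((∑ k, spikeAvgLik θ (p.1 k) p.2) / m)))
    (by fun_prop)

theorem ofReal_sq_le_risk_add {n m : ℕ} (hn : 0 < n) (hm0 : 0 < m) {δ : ℝ} (hδ : 0 < δ)
    (hδ1 : δ < 1) (hm : (1 - δ / 2) * m ≤ m - 1) (mu : ℝ) (hmu : 2 * (mu ^ 2 / n) < 1)
    (est : (Fin n → Fin m → ℝ) × (Fin n → ℝ) → Fin m → ℝ) (hest : Measurable est) :
    ENNReal.ofReal (mu ^ 2) ≤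
      ∫⁻ ω, ENNReal.ofReal
        (∑ j, (est (pmData n m mu ω) j - pmSignal m mu ω.2 j) ^ 2) ∂pmLaw n m +
      ENNReal.ofReal (mu ^ 2 / (2 * m) * ((1 - δ)⁻¹ * (1 + mu ^ 2 / n) ^ n + 256 / (δ ^ 4 * m) *
        ((1 + mu ^ 2 / n) ^ 2 / √(1 - 4 * (mu ^ 2 / n) ^ 2)) ^ n)) := by
  have hmR : (0 : ℝ) < m := by exact_mod_cast hm0
  have hprob := isProbabilityMeasure_pmLaw n hm0
  set Bd : ℝ := (1 - δ)⁻¹ * (1 + mu ^ 2 / n) ^ n + 256 / (δ ^ 4 * m) *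
    ((1 + mu ^ 2 / n) ^ 2 / √(1 - 4 * (mu ^ 2 / n) ^ 2)) ^ n with hBd
  have hδ' : 0 < 1 - δ := by linarith
  have hBd0 : 0 ≤ Bd := by positivity
  have hestj : ∀ j, Measurable fun p => est p j := fun j => (measurable_pi_apply j).comp hest
  have hconst := lintegral_pmLaw hm0 mu (n := n) (fun _ _ => ENNReal.ofReal (mu ^ 2))
    (fun _ => measurable_const)
  have hrisk := lintegral_pmLaw hm0 mu (n := n)
    (fun q p => ENNReal.ofReal (∑ j, (est p j - pmSignal m mu q j) ^ 2)) (fun q => by fun_prop)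
  rw [lintegral_const, measure_univ, mul_one] at hconst
  rw [hconst, hrisk]
  let A : Fin m → (Fin n → Fin m → ℝ) × (Fin n → ℝ) → ℝ := fun k p =>
    spikeLik mu (fun i => p.1 i k) p.2
  let B : Fin m → (Fin n → Fin m → ℝ) × (Fin n → ℝ) → ℝ := fun k p =>
    spikeLik (-mu) (fun i => p.1 i k) p.2
  let Z : (Fin n → Fin m → ℝ) × (Fin n → ℝ) → ℝ := fun p =>
    (∑ i, spikeAvgLik mu (fun i' => p.1 i' i) p.2) / m
  have hA : ∀ k p, 0 < A k p := fun k p => spikeLik_pos _ _ _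
  have hB : ∀ k p, 0 < B k p := fun k p => spikeLik_pos _ _ _
  have hZ : ∀ p, 0 ≤ Z p := fun p =>
    div_nonneg (Finset.sum_nonneg fun i _ => (spikeAvgLik_pos _ _ _).le) hmR.le
  have hAm : ∀ k, Measurable (A k) := fun k => by simp only [A]; fun_prop
  have hBm : ∀ k, Measurable (B k) := fun k => by simp only [B]; fun_prop
  have hZm : Measurable Z := by simp only [Z]; fun_prop
  have hcomb : ∀ p (u v : Fin m → ℝ), (∀ k, 0 ≤ u k) → (∀ k, 0 ≤ v k) →
      ∑ k, ENNReal.ofReal (2 * m : ℝ)⁻¹ * (ENNReal.ofReal (A k p) * ENNReal.ofReal (u k) +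
        ENNReal.ofReal (B k p) * ENNReal.ofReal (v k)) =
      ENNReal.ofReal (∑ k, (2 * m : ℝ)⁻¹ * (A k p * u k + B k p * v k)) := by
    intro p u v hu hv
    have hnn : ∀ k, 0 ≤ A k p * u k ∧ 0 ≤ B k p * v k := fun k =>
      ⟨mul_nonneg (hA k p).le (hu k), mul_nonneg (hB k p).le (hv k)⟩
    rw [ENNReal.ofReal_sum_of_nonneg fun k _ =>
      mul_nonneg (by positivity) (add_nonneg (hnn k).1 (hnn k).2)]
    refine Finset.sum_congr rfl fun k _ => ?_
    rw [ENNReal.ofReal_mul (by positivity), ENNReal.ofReal_add (hnn k).1 (hnn k).2,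
      ENNReal.ofReal_mul (hA k p).le, ENNReal.ofReal_mul (hB k p).le]
  have hpt : ∀ p, ∑ k, ENNReal.ofReal (2 * m : ℝ)⁻¹ *
        (ENNReal.ofReal (A k p) * ENNReal.ofReal (mu ^ 2) +
          ENNReal.ofReal (B k p) * ENNReal.ofReal (mu ^ 2)) ≤
      ∑ k, ENNReal.ofReal (2 * m : ℝ)⁻¹ * (ENNReal.ofReal (A k p) *
          ENNReal.ofReal (∑ j, (est p j - pmSignal m mu (k, true) j) ^ 2) +
        ENNReal.ofReal (B k p) *
          ENNReal.ofReal (∑ j, (est p j - pmSignal m mu (k, false) j) ^ 2)) +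
      ENNReal.ofReal (mu ^ 2 / (4 * m ^ 2)) *
        ∑ k, (ENNReal.ofReal (A k p ^ 2 / Z p) + ENNReal.ofReal (B k p ^ 2 / Z p)) := by
    intro p
    have hAB : ∀ k, 0 ≤ A k p ^ 2 / Z p ∧ 0 ≤ B k p ^ 2 / Z p := fun k =>
      ⟨div_nonneg (sq_nonneg _) (hZ p), div_nonneg (sq_nonneg _) (hZ p)⟩
    have hsum : ∑ k, (ENNReal.ofReal (A k p ^ 2 / Z p) + ENNReal.ofReal (B k p ^ 2 / Z p)) =
        ENNReal.ofReal (∑ k, (A k p ^ 2 / Z p + B k p ^ 2 / Z p)) := by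
      rw [ENNReal.ofReal_sum_of_nonneg fun k _ => add_nonneg (hAB k).1 (hAB k).2]
      exact Finset.sum_congr rfl fun k _ => (ENNReal.ofReal_add (hAB k).1 (hAB k).2).symm
    rw [hcomb p (fun _ => mu ^ 2) (fun _ => mu ^ 2) (fun _ => sq_nonneg _) (fun _ => sq_nonneg _),
      hcomb p (fun k => ∑ j, (est p j - pmSignal m mu (k, true) j) ^ 2)
        (fun k => ∑ j, (est p j - pmSignal m mu (k, false) j) ^ 2)
        (fun _ => Finset.sum_nonneg fun _ _ => sq_nonneg _)
        (fun _ => Finset.sum_nonneg fun _ _ => sq_nonneg _), hsum,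
      ← ENNReal.ofReal_mul (by positivity), ← ENNReal.ofReal_add]
    · apply ENNReal.ofReal_le_ofReal
      have := posterior_loss_lower_bound hm0 mu (fun k => A k p) (fun k => B k p) (est p)
        (fun k => hA k p) (fun k => hB k p)
      simpa [pmSignal, Z, spikeAvgLik, A, B] using this
    · refine Finset.sum_nonneg fun k _ => mul_nonneg (by positivity) (add_nonneg ?_ ?_)
      · exact mul_nonneg (hA k p).le (Finset.sum_nonneg fun _ _ => sq_nonneg _)
      · exact mul_nonneg (hB k p).le (Finset.sum_nonneg fun _ _ => sq_nonneg _)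
    · exact mul_nonneg (by positivity)
        (Finset.sum_nonneg fun k _ => add_nonneg (hAB k).1 (hAB k).2)
  refine (lintegral_mono hpt).trans ?_
  have hmeas : Measurable fun p => ∑ k, ENNReal.ofReal (2 * m : ℝ)⁻¹ * (ENNReal.ofReal (A k p) *
      ENNReal.ofReal (∑ j, (est p j - pmSignal m mu (k, true) j) ^ 2) +
      ENNReal.ofReal (B k p) *
        ENNReal.ofReal (∑ j, (est p j - pmSignal m mu (k, false) j) ^ 2)) := by
    fun_prop
  rw [lintegral_add_left hmeas]
  refine add_le_add le_rfl ?_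
  rw [lintegral_const_mul' _ _ ENNReal.ofReal_ne_top, lintegral_finsetSum _ fun k _ => by fun_prop]
  have hcol : ∀ k, ∫⁻ p, (ENNReal.ofReal (A k p ^ 2 / Z p) + ENNReal.ofReal (B k p ^ 2 / Z p))
      ∂pmNull n m ≤ ENNReal.ofReal (2 * Bd) := by
    intro k
    have h1 := lintegral_pmNull_spikeLik_sq_div_le hn hδ hδ1 hm mu hmu k
    have h2 := lintegral_pmNull_spikeLik_sq_div_le hn hδ hδ1 hm (-mu) (by rwa [neg_sq]) k
    simp only [spikeAvgLik_neg, neg_sq] at h2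
    rw [lintegral_add_left (by fun_prop), two_mul, ENNReal.ofReal_add hBd0 hBd0]
    exact add_le_add h1 h2
  calc _ ≤ ENNReal.ofReal (mu ^ 2 / (4 * m ^ 2)) * ∑ _k : Fin m, ENNReal.ofReal (2 * Bd) := by
        gcongr with k
        exact hcol k
    _ = ENNReal.ofReal (mu ^ 2 / (4 * m ^ 2) * (m * (2 * Bd))) := by
        rw [Finset.sum_const, Finset.card_univ, Fintype.card_fin, nsmul_eq_mul,
          ← ENNReal.ofReal_natCast, ← ENNReal.ofReal_mul (by positivity),
          ← ENNReal.ofReal_mul (by positivity)]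
    _ = _ := by
        congr 1
        field_simp
        ring

theorem pmBayesRisk_le (n : ℕ) {m : ℕ} (hm : 0 < m) (mu : ℝ) :
    pmBayesRisk n m mu ≤ ENNReal.ofReal (mu ^ 2) := by
  have hprob := isProbabilityMeasure_pmLaw n hm
  refine (iInf₂_le (fun _ _ => 0) measurable_const).trans_eq ?_
  have h : ∀ ω : PMOmega n m, ∑ j, ((0 : ℝ) - pmSignal m mu ω.2 j) ^ 2 = mu ^ 2 := by
    intro ω
    simp [pmSignal, ite_pow]
  simp_rw [h]
  rw [lintegral_const, measure_univ, mul_one]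

theorem sq_sub_pmBayesRisk_le {n m : ℕ} (hn : 0 < n) (hm0 : 0 < m) {δ : ℝ} (hδ : 0 < δ)
    (hδ1 : δ < 1) (hm : (1 - δ / 2) * m ≤ m - 1) (mu : ℝ) (hmu : 2 * (mu ^ 2 / n) < 1) :
    mu ^ 2 - (pmBayesRisk n m mu).toReal ≤
      mu ^ 2 / (2 * m) * ((1 - δ)⁻¹ * (1 + mu ^ 2 / n) ^ n + 256 / (δ ^ 4 * m) *
        ((1 + mu ^ 2 / n) ^ 2 / √(1 - 4 * (mu ^ 2 / n) ^ 2)) ^ n) := by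
  have hδ' : 0 < 1 - δ := by linarith
  have hfin : pmBayesRisk n m mu ≠ ⊤ :=
    ((pmBayesRisk_le n hm0 mu).trans_lt ENNReal.ofReal_lt_top).ne
  set K : ℝ := mu ^ 2 / (2 * m) * ((1 - δ)⁻¹ * (1 + mu ^ 2 / n) ^ n + 256 / (δ ^ 4 * m) *
    ((1 + mu ^ 2 / n) ^ 2 / √(1 - 4 * (mu ^ 2 / n) ^ 2)) ^ n) with hK
  have hK0 : 0 ≤ K := by positivity
  have h : ENNReal.ofReal (mu ^ 2) - ENNReal.ofReal K ≤ pmBayesRisk n m mu :=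
    le_iInf₂ fun est hest => tsub_le_iff_right.mpr
      (ofReal_sq_le_risk_add hn hm0 hδ hδ1 hm mu hmu est hest)
  rw [← ENNReal.ofReal_sub _ hK0] at h
  linarith [(ENNReal.ofReal_le_iff_le_toReal hfin).mp h]

theorem inv_sqrt_one_sub_le_exp {x : ℝ} (hx : 0 ≤ x) (hx2 : x ≤ 1 / 2) :
    (√(1 - x))⁻¹ ≤ Real.exp x := by
  have h : Real.exp (-x) ≤ √(1 - x) := by
    apply Real.le_sqrt_of_sq_le
    rw [← Real.exp_nat_mul, show ((2 : ℕ) : ℝ) * -x = -(2 * x) by push_cast; ring, Real.exp_neg,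
      inv_le_iff_one_le_mul₀ (Real.exp_pos _)]
    nlinarith [Real.add_one_le_exp (2 * x)]
  calc (√(1 - x))⁻¹ ≤ (Real.exp (-x))⁻¹ := by gcongr
    _ = Real.exp x := by rw [Real.exp_neg, inv_inv]

theorem normalized_risk_gap_le {n m : ℕ} (hn : 0 < n) (hm0 : 0 < m) {δ : ℝ} (hδ : 0 < δ)
    (hδ1 : δ < 1) (hm : (1 - δ / 2) * m ≤ m - 1) {mu : ℝ} (hmu0 : 0 < mu)
    (hmu : mu ^ 4 / n ≤ 1 / 32) :
    (mu ^ 2 - (pmBayesRisk n m mu).toReal) * (2 * m) / (mu ^ 2 * Real.exp (mu ^ 2)) ≤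
      (1 - δ)⁻¹ + 256 * Real.exp 1 / δ ^ 4 * (Real.exp (mu ^ 2) / m) := by
  have hmR : (0 : ℝ) < m := by exact_mod_cast hm0
  have hnR : (1 : ℝ) ≤ n := by exact_mod_cast hn
  have hδ' : 0 < 1 - δ := by linarith
  set s : ℝ := mu ^ 2 / n with hs
  have hs0 : 0 ≤ s := by positivity
  have hns : n * s = mu ^ 2 := by rw [hs]; field_simp
  have hns2 : n * s ^ 2 ≤ 1 / 32 := by
    have : n * s ^ 2 = mu ^ 4 / n := by rw [hs]; field_simp
    rwa [this]
  have hs2 : s ^ 2 ≤ 1 / 32 := by nlinarith [sq_nonneg s]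
  have hs3 : 2 * s < 1 := by nlinarith
  have hgap := sq_sub_pmBayesRisk_le hn hm0 hδ hδ1 hm mu hs3
  have hpow : (1 + s) ^ n ≤ Real.exp (mu ^ 2) := by
    calc (1 + s) ^ n ≤ Real.exp s ^ n := by
          gcongr
          linarith [Real.add_one_le_exp s]
      _ = Real.exp (mu ^ 2) := by rw [← Real.exp_nat_mul, hns]
  have hpow2 : ((1 + s) ^ 2 / √(1 - 4 * s ^ 2)) ^ n ≤
      Real.exp (mu ^ 2) * Real.exp (mu ^ 2) * Real.exp 1 := by
    have h1 : ((√(1 - 4 * s ^ 2))⁻¹) ^ n ≤ Real.exp 1 := by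
      calc ((√(1 - 4 * s ^ 2))⁻¹) ^ n ≤ Real.exp (4 * s ^ 2) ^ n := by
            gcongr
            exact inv_sqrt_one_sub_le_exp (by positivity) (by linarith)
        _ = Real.exp (n * (4 * s ^ 2)) := by rw [← Real.exp_nat_mul]
        _ ≤ Real.exp 1 := Real.exp_le_exp.mpr (by linarith)
    calc ((1 + s) ^ 2 / √(1 - 4 * s ^ 2)) ^ n
        = (1 + s) ^ n * (1 + s) ^ n * ((√(1 - 4 * s ^ 2))⁻¹) ^ n := by
          rw [div_eq_mul_inv, mul_pow, ← pow_mul, mul_comm 2 n, pow_mul]; ring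
      _ ≤ _ := by gcongr
  rw [div_le_iff₀ (by positivity)]
  calc (mu ^ 2 - (pmBayesRisk n m mu).toReal) * (2 * m)
      ≤ mu ^ 2 / (2 * m) * ((1 - δ)⁻¹ * (1 + s) ^ n + 256 / (δ ^ 4 * m) *
        ((1 + s) ^ 2 / √(1 - 4 * s ^ 2)) ^ n) * (2 * m) := by gcongr
    _ ≤ mu ^ 2 / (2 * m) * ((1 - δ)⁻¹ * Real.exp (mu ^ 2) + 256 / (δ ^ 4 * m) *
        (Real.exp (mu ^ 2) * Real.exp (mu ^ 2) * Real.exp 1)) * (2 * m) := by gcongr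
    _ = _ := by field_simp

theorem tendsto_exp_sq_div_zero {m : ℕ → ℕ} {mu : ℕ → ℝ} (hmu0 : ∀ n, 0 < mu n)
    (hm : Tendsto (fun n => (m n : ℝ)) atTop atTop)
    (hmuo : Tendsto (fun n => mu n / Real.sqrt (Real.log (m n))) atTop (nhds 0)) :
    Tendsto (fun n => Real.exp (mu n ^ 2) / m n) atTop (nhds 0) := by
  have hlim : Tendsto (fun n => (√(m n : ℝ))⁻¹) atTop (nhds 0) :=
    tendsto_inv_atTop_zero.comp (Real.tendsto_sqrt_atTop.comp hm)
  refine squeeze_zero' (Eventually.of_forall fun n => by positivity) ?_ hlim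
  filter_upwards [hm.eventually_gt_atTop 1, hmuo.eventually_le_const (show (0 : ℝ) < 1 / 2 by norm_num)]
    with n h1 h2
  have hlog : 0 < Real.log (m n) := Real.log_pos h1
  have hmpos : (0 : ℝ) < m n := by linarith
  rw [div_le_iff₀ (Real.sqrt_pos.mpr hlog)] at h2
  have h3 : mu n ^ 2 ≤ Real.log (m n) / 2 := by
    have h4 := Real.sq_sqrt hlog.le
    have h5 : mu n ^ 2 ≤ (1 / 2 * √(Real.log (m n))) ^ 2 := pow_le_pow_left₀ (hmu0 n).le h2 2
    nlinarith
  have h6 : Real.exp (mu n ^ 2) ≤ √(m n : ℝ) := by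
    calc Real.exp (mu n ^ 2) ≤ Real.exp (Real.log (m n) / 2) := Real.exp_le_exp.mpr h3
      _ = √(m n : ℝ) := by rw [Real.exp_half, Real.exp_log hmpos]
  calc Real.exp (mu n ^ 2) / m n ≤ √(m n : ℝ) / m n := by gcongr
    _ = (√(m n : ℝ))⁻¹ := by rw [Real.sqrt_div_self', one_div]


/-- **Lemma 10.** For the symmetric spike prior with `m → ∞`, `(log m)/n → 0`,
`μ → ∞`, `μ = o(√(log m))` and `μ⁴/n → 0`, the Bayes risk satisfies
`B(π_{±S}(μ; m)) ≥ μ² − (μ² e^{μ²}/(2m))(1 + o(1))`, i.e.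
`limsup (μ² − B) · 2m/(μ² e^{μ²}) ≤ 1`. -/
theorem pm_spike_bayes_risk_lower_medSNR
    (m : ℕ → ℕ) (mu : ℕ → ℝ)
    (hm0 : ∀ n, 0 < m n) (hmu0 : ∀ n, 0 < mu n)
    (hm : Tendsto (fun n => (m n : ℝ)) atTop atTop)
    (hlog : Tendsto (fun n => Real.log (m n) / n) atTop (nhds 0))
    (hmu : Tendsto (fun n => mu n) atTop atTop)
    (hmuo : Tendsto (fun n => mu n / Real.sqrt (Real.log (m n))) atTop (nhds 0))
    (hmu4 : Tendsto (fun n => mu n ^ 4 / n) atTop (nhds 0)) :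
    Filter.limsup (fun n =>
        (mu n ^ 2 - (pmBayesRisk n (m n) (mu n)).toReal) * (2 * m n) /
          (mu n ^ 2 * Real.exp (mu n ^ 2))) atTop ≤ 1 := by
  have hnonneg : ∀ n, 0 ≤ (mu n ^ 2 - (pmBayesRisk n (m n) (mu n)).toReal) * (2 * m n) /
      (mu n ^ 2 * Real.exp (mu n ^ 2)) := by
    intro n
    have h := ENNReal.toReal_mono ENNReal.ofReal_ne_top (pmBayesRisk_le n (hm0 n) (mu n))
    rw [ENNReal.toReal_ofReal (sq_nonneg _)] at h
    have h' : 0 ≤ mu n ^ 2 - (pmBayesRisk n (m n) (mu n)).toReal := by linarith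
    positivity
  refine le_of_forall_pos_le_add fun ε hε => ?_
  set δ : ℝ := 1 - (1 + ε / 2)⁻¹ with hδdef
  have hinv : (1 + ε / 2)⁻¹ < 1 := inv_lt_one_of_one_lt₀ (by linarith)
  have hinv0 : 0 < (1 + ε / 2)⁻¹ := by positivity
  have hδ : 0 < δ := by linarith
  have hδ1 : δ < 1 := by linarith
  have hδinv : (1 - δ)⁻¹ = 1 + ε / 2 := by rw [hδdef, sub_sub_cancel, inv_inv]
  have hrem : Tendsto (fun n => 256 * Real.exp 1 / δ ^ 4 * (Real.exp (mu n ^ 2) / m n))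
      atTop (nhds 0) := by
    simpa using (tendsto_exp_sq_div_zero hmu0 hm hmuo).const_mul (256 * Real.exp 1 / δ ^ 4)
  refine limsup_le_of_le (isCoboundedUnder_le_of_le atTop hnonneg) ?_
  filter_upwards [eventually_gt_atTop 0, hm.eventually_ge_atTop (2 / δ),
    hmu4.eventually_le_const (show (0 : ℝ) < 1 / 32 by norm_num),
    hrem.eventually_le_const (half_pos hε)] with n hn hmn hmun hremn
  have hm' : (1 - δ / 2) * m n ≤ m n - 1 := by
    rw [div_le_iff₀ hδ] at hmn
    linarith
  have := normalized_risk_gap_le hn (hm0 n) hδ hδ1 hm' (hmu0 n) hmun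
  rw [hδinv] at this
  linarith
end
end

section
/- Let Q be a chi-squared random variable with n > 2 degrees of freedom. Then: (a) for all c₁, c₂ > 0, E( Q^{c₁}·e^{−c₂/Q} ) ≥ (n−2)^{c₁}·e^{−c₂/(n−2)}; and (b) there is an absolute constant C > 0 such that for all c₁ ≥ 1/4 and 0 < c₂ < n²/36, E( Q^{c₁}·e^{−c₂/Q} ) ≤ (n+6√c₂)^{c₁}·e^{−c₂/(n+6√c₂)} + (C√c₁ + √n)^{2c₁}·e^{−2c₂/(n+6√c₂)}. -/
open MeasureTheory ProbabilityTheory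
open scoped NNReal ENNReal

noncomputable section

/-- `E(Q^{c₁} e^{−c₂/Q})` where `Q ~ χ²_n` is the sum of squares of `n` independent
standard Gaussians. -/
def chiSqMoment (n : ℕ) (c₁ c₂ : ℝ) : ℝ :=
  ∫ z, (∑ i, z i ^ 2) ^ c₁ * Real.exp (-c₂ / ∑ i, z i ^ 2)
    ∂(Measure.pi fun _ : Fin n => gaussianReal 0 1)

theorem integral_exp_mul_sq_gaussianReal {s : ℝ} (hs : s < 1 / 2) :
    ∫ x, Real.exp (s * x ^ 2) ∂(gaussianReal 0 1) = (1 - 2 * s) ^ (-(1 / 2) : ℝ) := by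
  have hfactor (x : ℝ) : gaussianPDFReal 0 1 x • Real.exp (s * x ^ 2) =
      (√(2 * Real.pi))⁻¹ * Real.exp (-(1 / 2 - s) * x ^ 2) := by
    simp only [gaussianPDFReal, NNReal.coe_one, mul_one, sub_zero, smul_eq_mul]
    rw [mul_assoc, ← Real.exp_add]
    ring_nf
  rw [integral_gaussianReal_eq_integral_smul one_ne_zero]
  simp_rw [hfactor]
  rw [integral_const_mul, integral_gaussian, ← Real.sqrt_inv, ← Real.sqrt_mul (by positivity),
    Real.rpow_neg (by linarith), ← Real.sqrt_eq_rpow, ← Real.sqrt_inv]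
  congr 1
  have : 1 / 2 - s ≠ 0 := by linarith
  have : 1 - 2 * s ≠ 0 := by linarith
  field_simp

/-- The moment generating function of the chi-squared distribution. -/
theorem integral_exp_mul_sum_sq (n : ℕ) {s : ℝ} (hs : s < 1 / 2) :
    ∫ z, Real.exp (s * ∑ i, z i ^ 2) ∂(Measure.pi fun _ : Fin n => gaussianReal 0 1) =
      (1 - 2 * s) ^ (-(n / 2) : ℝ) := by
  simp_rw [Finset.mul_sum, Real.exp_sum]
  rw [integral_fintype_prod_eq_pow (fun x : ℝ => Real.exp (s * x ^ 2)),
    integral_exp_mul_sq_gaussianReal hs, Fintype.card_fin, ← Real.rpow_mul_natCast (by linarith)]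
  ring_nf

theorem integrable_exp_mul_sum_sq (n : ℕ) {s : ℝ} (hs : s < 1 / 2) :
    Integrable (fun z => Real.exp (s * ∑ i, z i ^ 2))
      (Measure.pi fun _ : Fin n => gaussianReal 0 1) := by
  refine Integrable.of_integral_ne_zero ?_
  rw [integral_exp_mul_sum_sq n hs]
  exact (Real.rpow_pos_of_pos (by linarith) _).ne'

theorem rpow_le_mul_exp {x c s : ℝ} (hx : 0 ≤ x) (hc : 0 < c) (hs : 0 < s) :
    x ^ c ≤ (c / s) ^ c * Real.exp (-c) * Real.exp (s * x) := by
  have hscale : x = c / s * (s * x / c) := by field_simp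
  have hle : s * x / c ≤ Real.exp (s * x / c - 1) := by
    simpa using Real.add_one_le_exp (s * x / c - 1)
  calc x ^ c = (c / s) ^ c * (s * x / c) ^ c := by
        rw [← Real.mul_rpow (by positivity) (by positivity), ← hscale]
    _ ≤ (c / s) ^ c * Real.exp (s * x / c - 1) ^ c := by gcongr
    _ = (c / s) ^ c * Real.exp (-c) * Real.exp (s * x) := by
        rw [← Real.exp_mul, mul_assoc, ← Real.exp_add]
        congr 2
        field_simp
        ring

theorem log_le_half_sub_inv {x : ℝ} (hx : 1 ≤ x) : Real.log x ≤ (x - x⁻¹) / 2 := by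
  rw [← Real.sinh_log (by linarith)]
  exact Real.self_le_sinh_iff.2 (Real.log_nonneg hx)

theorem lintegral_Ioi_exp_neg_mul {x : ℝ} (hx : 0 ≤ x) :
    ∫⁻ t in Set.Ioi (0 : ℝ), ENNReal.ofReal (Real.exp (-t * x)) = (ENNReal.ofReal x)⁻¹ := by
  rcases hx.eq_or_lt with rfl | hx
  · simp
  have hcomm (t : ℝ) : -t * x = -x * t := by ring
  simp_rw [hcomm]
  rw [← ofReal_integral_eq_lintegral_ofReal (integrableOn_exp_mul_Ioi (by linarith) 0)
    (ae_of_all _ fun _ => (Real.exp_pos _).le), integral_exp_mul_Ioi (by linarith) 0,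
    ← ENNReal.ofReal_inv_of_pos hx]
  simp

theorem lintegral_Ioi_one_add_two_mul_rpow {a : ℝ} (ha : 2 < a) :
    ∫⁻ t in Set.Ioi (0 : ℝ), ENNReal.ofReal ((1 + 2 * t) ^ (-(a / 2))) =
      ENNReal.ofReal (a - 2)⁻¹ := by
  have hderiv : ∀ t ∈ Set.Ici (0 : ℝ),
      HasDerivAt (fun t : ℝ => -(a - 2)⁻¹ * (1 + 2 * t) ^ (-(a / 2 - 1)))
        ((1 + 2 * t) ^ (-(a / 2))) t := by
    intro t ht
    have ht : 0 ≤ t := ht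
    have hlin : HasDerivAt (fun t : ℝ => 1 + 2 * t) 2 t := by
      simpa using ((hasDerivAt_id t).const_mul 2).const_add 1
    convert! (hlin.rpow_const (p := -(a / 2 - 1))
      (Or.inl (by positivity))).const_mul (-(a - 2)⁻¹) using 1
    have : a - 2 ≠ 0 := by linarith
    rw [show -(a / 2 - 1) - 1 = -(a / 2) by ring]
    field_simp
  have hlim : Filter.Tendsto (fun t : ℝ => -(a - 2)⁻¹ * (1 + 2 * t) ^ (-(a / 2 - 1)))
      Filter.atTop (nhds 0) := by
    have hlin : Filter.Tendsto (fun t : ℝ => 1 + 2 * t) Filter.atTop Filter.atTop :=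
      Filter.tendsto_atTop_add_const_left _ _ (Filter.tendsto_id.const_mul_atTop two_pos)
    simpa using ((tendsto_rpow_neg_atTop (by linarith : 0 < a / 2 - 1)).comp hlin).const_mul
      (-(a - 2)⁻¹)
  have hnonneg : ∀ t ∈ Set.Ioi (0 : ℝ), 0 ≤ (1 + 2 * t) ^ (-(a / 2)) := by
    intro t ht
    have ht : 0 < t := ht
    positivity
  rw [← ofReal_integral_eq_lintegral_ofReal (integrableOn_Ioi_deriv_of_nonneg' hderiv hnonneg hlim)
    ((ae_restrict_iff' measurableSet_Ioi).2 (ae_of_all _ hnonneg)),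
    integral_Ioi_of_hasDerivAt_of_nonneg' hderiv hnonneg hlim]
  simp

theorem measurable_inv_ofReal_sum_sq (n : ℕ) :
    Measurable fun z : Fin n → ℝ => (ENNReal.ofReal (∑ i, z i ^ 2))⁻¹ :=
  Measurable.inv (by fun_prop)

/-- The first inverse moment of the chi-squared distribution. -/
theorem lintegral_inv_sum_sq {n : ℕ} (hn : 2 < n) :
    ∫⁻ z, (ENNReal.ofReal (∑ i, z i ^ 2))⁻¹ ∂(Measure.pi fun _ : Fin n => gaussianReal 0 1) =
      ENNReal.ofReal ((n : ℝ) - 2)⁻¹ := by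
  calc
    _ = ∫⁻ z, (∫⁻ t in Set.Ioi (0 : ℝ), ENNReal.ofReal (Real.exp (-t * ∑ i, z i ^ 2)))
          ∂(Measure.pi fun _ : Fin n => gaussianReal 0 1) :=
        lintegral_congr fun z => (lintegral_Ioi_exp_neg_mul (by positivity)).symm
    _ = ∫⁻ t in Set.Ioi (0 : ℝ), ∫⁻ z, ENNReal.ofReal (Real.exp (-t * ∑ i, z i ^ 2))
          ∂(Measure.pi fun _ : Fin n => gaussianReal 0 1) :=
        lintegral_lintegral_swap (by fun_prop)
    _ = ∫⁻ t in Set.Ioi (0 : ℝ), ENNReal.ofReal ((1 + 2 * t) ^ (-((n : ℝ) / 2))) := by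
        refine setLIntegral_congr_fun measurableSet_Ioi fun t ht => ?_
        have hs : -t < 1 / 2 := by
          have : 0 < t := ht
          linarith
        rw [← ofReal_integral_eq_lintegral_ofReal (integrable_exp_mul_sum_sq n hs)
          (ae_of_all _ fun _ => (Real.exp_pos _).le), integral_exp_mul_sum_sq n hs]
        ring_nf
    _ = _ := lintegral_Ioi_one_add_two_mul_rpow (by exact_mod_cast hn)

theorem ae_sum_sq_pos {n : ℕ} (hn : 2 < n) :
    ∀ᵐ z ∂(Measure.pi fun _ : Fin n => gaussianReal 0 1), 0 < ∑ i, z i ^ 2 := by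
  have hlt := ae_lt_top (μ := Measure.pi fun _ : Fin n => gaussianReal 0 1)
    (measurable_inv_ofReal_sum_sq n) (by simp [lintegral_inv_sum_sq hn])
  filter_upwards [hlt] with z hz
  simpa using hz

theorem integrable_inv_sum_sq {n : ℕ} (hn : 2 < n) :
    Integrable (fun z => (∑ i, z i ^ 2)⁻¹) (Measure.pi fun _ : Fin n => gaussianReal 0 1) := by
  have hint := integrable_toReal_of_lintegral_ne_top
    (μ := Measure.pi fun _ : Fin n => gaussianReal 0 1)
    (measurable_inv_ofReal_sum_sq n).aemeasurable (by simp [lintegral_inv_sum_sq hn])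
  refine hint.congr (ae_of_all _ fun z => ?_)
  simp only [ENNReal.toReal_inv]
  rw [ENNReal.toReal_ofReal (by positivity)]

theorem integral_inv_sum_sq {n : ℕ} (hn : 2 < n) :
    ∫ z, (∑ i, z i ^ 2)⁻¹ ∂(Measure.pi fun _ : Fin n => gaussianReal 0 1) =
      ((n : ℝ) - 2)⁻¹ := by
  have hn' : (2 : ℝ) < n := by exact_mod_cast hn
  have hpos : 0 ≤ ((n : ℝ) - 2)⁻¹ := inv_nonneg.2 (by linarith)
  rw [integral_eq_lintegral_of_nonneg_ae (ae_of_all _ fun z => by positivity)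
    (integrable_inv_sum_sq hn).aestronglyMeasurable]
  rw [lintegral_congr_ae (g := fun z => (ENNReal.ofReal (∑ i, z i ^ 2))⁻¹)
    ((ae_sum_sq_pos hn).mono fun z hz => ENNReal.ofReal_inv_of_pos hz), lintegral_inv_sum_sq hn,
    ENNReal.toReal_ofReal hpos]

theorem integrable_rpow_mul_exp_neg_div_sum_sq (n : ℕ) {c₁ c₂ : ℝ} (hc₁ : 0 < c₁)
    (hc₂ : 0 ≤ c₂) :
    Integrable (fun z => (∑ i, z i ^ 2) ^ c₁ * Real.exp (-c₂ / ∑ i, z i ^ 2))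
      (Measure.pi fun _ : Fin n => gaussianReal 0 1) := by
  refine ((integrable_exp_mul_sum_sq n (by norm_num : (1 / 4 : ℝ) < 1 / 2)).const_mul
    ((c₁ / (1 / 4)) ^ c₁ * Real.exp (-c₁))).mono' (by fun_prop) (ae_of_all _ fun z => ?_)
  have hq : 0 ≤ ∑ i, z i ^ 2 := by positivity
  rw [Real.norm_of_nonneg (by positivity)]
  calc (∑ i, z i ^ 2) ^ c₁ * Real.exp (-c₂ / ∑ i, z i ^ 2) ≤ (∑ i, z i ^ 2) ^ c₁ * 1 := by
        gcongr
        rw [Real.exp_le_one_iff]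
        exact div_nonpos_of_nonpos_of_nonneg (by linarith) hq
    _ ≤ _ := by
        rw [mul_one]
        exact rpow_le_mul_exp hq hc₁ (by norm_num)

/-- Tangent line bound for the convex function `x ↦ x ^ (-c₁) * exp (-c₂ * x)`
of `x = q⁻¹` at `x = m⁻¹`. -/
theorem rpow_mul_exp_neg_div_ge {q m c₁ c₂ : ℝ} (hq : 0 < q) (hm : 0 < m) (hc₁ : 0 ≤ c₁) :
    m ^ c₁ * Real.exp (-(c₂ / m)) * (1 + (c₁ * m + c₂) * (m⁻¹ - q⁻¹)) ≤
      q ^ c₁ * Real.exp (-c₂ / q) := by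
  have hlog : Real.log m - Real.log q ≤ m / q - 1 := by
    rw [← Real.log_div hm.ne' hq.ne']
    exact Real.log_le_sub_one_of_pos (by positivity)
  have hexp : q ^ c₁ * Real.exp (-c₂ / q) = m ^ c₁ * Real.exp (-(c₂ / m)) *
      Real.exp (c₁ * (Real.log q - Real.log m) + c₂ * (m⁻¹ - q⁻¹)) := by
    rw [Real.rpow_def_of_pos hq, Real.rpow_def_of_pos hm, ← Real.exp_add, ← Real.exp_add,
      ← Real.exp_add]
    ring_nf
  rw [hexp]
  gcongr
  refine le_trans ?_ (Real.add_one_le_exp _)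
  have hmul : (c₁ * m + c₂) * (m⁻¹ - q⁻¹) = c₁ * (1 - m / q) + c₂ * (m⁻¹ - q⁻¹) := by
    field_simp
  rw [hmul]
  nlinarith [mul_le_mul_of_nonneg_left hlog hc₁]

theorem le_chiSqMoment {n : ℕ} (hn : 2 < n) {c₁ c₂ : ℝ} (hc₁ : 0 < c₁) (hc₂ : 0 ≤ c₂) :
    ((n : ℝ) - 2) ^ c₁ * Real.exp (-(c₂ / ((n : ℝ) - 2))) ≤ chiSqMoment n c₁ c₂ := by
  have hm : (0 : ℝ) < n - 2 := sub_pos.2 (by exact_mod_cast hn)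
  set m : ℝ := n - 2 with hm_def
  have hdiff : Integrable (fun z => m⁻¹ - (∑ i, z i ^ 2)⁻¹)
      (Measure.pi fun _ : Fin n => gaussianReal 0 1) :=
    (integrable_const m⁻¹).sub (integrable_inv_sum_sq hn)
  have hint : Integrable (fun z => m ^ c₁ * Real.exp (-(c₂ / m)) *
      (1 + (c₁ * m + c₂) * (m⁻¹ - (∑ i, z i ^ 2)⁻¹)))
      (Measure.pi fun _ : Fin n => gaussianReal 0 1) :=
    ((integrable_const 1).add (hdiff.const_mul _)).const_mul _
  have hval : ∫ z, m ^ c₁ * Real.exp (-(c₂ / m)) *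
      (1 + (c₁ * m + c₂) * (m⁻¹ - (∑ i, z i ^ 2)⁻¹))
      ∂(Measure.pi fun _ : Fin n => gaussianReal 0 1) = m ^ c₁ * Real.exp (-(c₂ / m)) := by
    rw [integral_const_mul, integral_add (integrable_const 1) (hdiff.const_mul _),
      integral_const_mul, integral_sub (integrable_const _) (integrable_inv_sum_sq hn),
      integral_inv_sum_sq hn]
    simp [hm_def]
  rw [← hval]
  refine integral_mono_ae hint (integrable_rpow_mul_exp_neg_div_sum_sq n hc₁ hc₂) ?_
  filter_upwards [ae_sum_sq_pos hn] with z hz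
  exact rpow_mul_exp_neg_div_ge hz hm hc₁.le

/-- Truncation at `K`: below `K` use monotonicity in `q`, above `K` use exponential moments. -/
theorem rpow_mul_exp_neg_div_le {q K c₁ c₂ s t : ℝ} (hq : 0 ≤ q) (hK : 0 < K) (hc₁ : 0 < c₁)
    (hc₂ : 0 ≤ c₂) (hs : 0 < s) (ht : 0 ≤ t) :
    q ^ c₁ * Real.exp (-c₂ / q) ≤ K ^ c₁ * Real.exp (-(c₂ / K)) +
      (c₁ / s) ^ c₁ * Real.exp (-c₁) * Real.exp (-(t * K)) * Real.exp ((s + t) * q) := by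
  rcases hq.eq_or_lt with rfl | hq
  · rw [Real.zero_rpow hc₁.ne', zero_mul]
    positivity
  rcases le_or_gt q K with hqK | hqK
  · refine le_add_of_le_of_nonneg ?_ (by positivity)
    rw [neg_div]
    gcongr
  · refine le_add_of_nonneg_of_le (by positivity) ?_
    have hone : Real.exp (-c₂ / q) ≤ 1 :=
      Real.exp_le_one_iff.2 (div_nonpos_of_nonpos_of_nonneg (by linarith) hq.le)
    have htail : Real.exp (s * q) ≤ Real.exp (-(t * K)) * Real.exp ((s + t) * q) := by
      rw [← Real.exp_add, Real.exp_le_exp]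
      nlinarith [mul_le_mul_of_nonneg_left hqK.le ht]
    calc q ^ c₁ * Real.exp (-c₂ / q) ≤ q ^ c₁ * 1 := by gcongr
      _ ≤ (c₁ / s) ^ c₁ * Real.exp (-c₁) * Real.exp (s * q) := by
          rw [mul_one]
          exact rpow_le_mul_exp hq.le hc₁ hs
      _ ≤ (c₁ / s) ^ c₁ * Real.exp (-c₁) * (Real.exp (-(t * K)) * Real.exp ((s + t) * q)) := by
          gcongr
      _ = _ := by ring

theorem chiSqMoment_le_of_add_lt (n : ℕ) {K c₁ c₂ s t : ℝ} (hK : 0 < K) (hc₁ : 0 < c₁)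
    (hc₂ : 0 ≤ c₂) (hs : 0 < s) (ht : 0 ≤ t) (hst : s + t < 1 / 2) :
    chiSqMoment n c₁ c₂ ≤ K ^ c₁ * Real.exp (-(c₂ / K)) +
      (c₁ / s) ^ c₁ * Real.exp (-c₁) * Real.exp (-(t * K)) *
        (1 - 2 * (s + t)) ^ (-(n / 2) : ℝ) := by
  have hexp := (integrable_exp_mul_sum_sq n hst).const_mul
    ((c₁ / s) ^ c₁ * Real.exp (-c₁) * Real.exp (-(t * K)))
  calc chiSqMoment n c₁ c₂
      ≤ ∫ z, (K ^ c₁ * Real.exp (-(c₂ / K)) + (c₁ / s) ^ c₁ * Real.exp (-c₁) *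
          Real.exp (-(t * K)) * Real.exp ((s + t) * ∑ i, z i ^ 2))
          ∂(Measure.pi fun _ : Fin n => gaussianReal 0 1) :=
        integral_mono (integrable_rpow_mul_exp_neg_div_sum_sq n hc₁ hc₂)
          ((integrable_const _).add hexp)
          fun z => rpow_mul_exp_neg_div_le (by positivity) hK hc₁ hc₂ hs ht
    _ = _ := by
        rw [integral_add (integrable_const _) hexp, integral_const, integral_const_mul,
          integral_exp_mul_sum_sq n hst]
        simp

/-- The moment generating function at a sum of two points, by Cauchy-Schwarz. -/
theorem one_sub_add_rpow_neg_le {N D c : ℝ} (hN : 0 < N) (hD : 0 ≤ D) (hc : 0 ≤ c) :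
    (1 - 2 * (c / (N + 4 * c) + D / (4 * (N + D)))) ^ (-(N / 2)) ≤
      Real.exp (c + ((N + D) - N ^ 2 / (N + D)) / 8) := by
  have hM : 0 < N + 4 * c := by positivity
  have hK : 0 < N + D := by positivity
  have hmean : 1 - 2 * (c / (N + 4 * c) + D / (4 * (N + D))) =
      (N / (N + 4 * c) + N / (N + D)) / 2 := by
    field_simp
    ring
  set x := N / (N + 4 * c) with hx
  set y := N / (N + D) with hy
  have hx0 : 0 < x := by positivity
  have hy0 : 0 < y := by positivity
  have hsq : x * y ≤ ((x + y) / 2) ^ 2 := by nlinarith [sq_nonneg (x - y)]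
  have hlog : Real.log x + Real.log y ≤ 2 * Real.log ((x + y) / 2) := by
    rw [← Real.log_mul hx0.ne' hy0.ne']
    simpa using Real.log_le_log (by positivity) hsq
  have hlogx : -Real.log x ≤ 4 * c / N := by
    rw [← Real.log_inv]
    refine (Real.log_le_sub_one_of_pos (by positivity)).trans (le_of_eq ?_)
    rw [hx]
    field_simp
    ring
  have hlogy : -Real.log y ≤ ((N + D) / N - N / (N + D)) / 2 := by
    have hle : 1 ≤ (N + D) / N := by
      rw [le_div_iff₀ hN]
      linarith
    rw [← Real.log_inv, hy, inv_div]
    simpa using log_le_half_sub_inv hle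
  rw [hmean, Real.rpow_def_of_pos (by positivity), Real.exp_le_exp]
  calc Real.log ((x + y) / 2) * -(N / 2) ≤ N / 4 * (-Real.log x + -Real.log y) := by nlinarith
    _ ≤ N / 4 * (4 * c / N + ((N + D) / N - N / (N + D)) / 2) := by gcongr
    _ = _ := by
        field_simp
        ring

theorem chiSqMoment_le {n : ℕ} (hn : 0 < n) {c₁ c₂ : ℝ} (hc₁ : 0 < c₁) (hc₂ : 0 ≤ c₂) :
    chiSqMoment n c₁ c₂ ≤
      ((n : ℝ) + 6 * Real.sqrt c₂) ^ c₁ * Real.exp (-(c₂ / ((n : ℝ) + 6 * Real.sqrt c₂))) +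
        (2 * Real.sqrt c₁ + Real.sqrt n) ^ (2 * c₁) *
          Real.exp (-(2 * c₂ / ((n : ℝ) + 6 * Real.sqrt c₂))) := by
  have hN : (0 : ℝ) < n := by exact_mod_cast hn
  set N : ℝ := (n : ℝ)
  have hD : 0 ≤ 6 * Real.sqrt c₂ := by positivity
  have hDsq : (6 * Real.sqrt c₂) ^ 2 = 36 * c₂ := by
    rw [mul_pow, Real.sq_sqrt hc₂]
    norm_num
  set D : ℝ := 6 * Real.sqrt c₂
  have hM : 0 < N + 4 * c₁ := by positivity
  have hK : 0 < N + D := by positivity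
  have hs : c₁ / (N + 4 * c₁) < 1 / 4 := by
    rw [div_lt_iff₀ hM]
    linarith
  have ht : D / (4 * (N + D)) < 1 / 4 := by
    rw [div_lt_iff₀ (by positivity)]
    linarith
  refine (chiSqMoment_le_of_add_lt n (K := N + D) (s := c₁ / (N + 4 * c₁))
    (t := D / (4 * (N + D))) hK hc₁ hc₂ (by positivity) (by positivity) (by linarith)).trans ?_
  have hbase : N + 4 * c₁ ≤ (2 * Real.sqrt c₁ + Real.sqrt N) ^ 2 := by
    have := Real.sq_sqrt hc₁.le
    have := Real.sq_sqrt hN.le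
    nlinarith [mul_nonneg (Real.sqrt_nonneg c₁) (Real.sqrt_nonneg N)]
  have hpow : (N + 4 * c₁) ^ c₁ ≤ (2 * Real.sqrt c₁ + Real.sqrt N) ^ (2 * c₁) := by
    rw [Real.rpow_mul (by positivity), Real.rpow_two]
    gcongr
  have hexp : Real.exp (-c₁) * Real.exp (-(D / (4 * (N + D)) * (N + D))) *
      Real.exp (c₁ + ((N + D) - N ^ 2 / (N + D)) / 8) ≤ Real.exp (-(2 * c₂ / (N + D))) := by
    rw [← Real.exp_add, ← Real.exp_add, Real.exp_le_exp]
    have hsum : -c₁ + -(D / (4 * (N + D)) * (N + D)) +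
        (c₁ + ((N + D) - N ^ 2 / (N + D)) / 8) = -(D ^ 2 / 8 / (N + D)) := by
      field_simp
      ring
    rw [hsum, hDsq]
    gcongr
    linarith
  have hcancel : c₁ / (c₁ / (N + 4 * c₁)) = N + 4 * c₁ := by field_simp
  rw [hcancel]
  refine add_le_add_right ?_ _
  calc _ ≤ (N + 4 * c₁) ^ c₁ * Real.exp (-c₁) * Real.exp (-(D / (4 * (N + D)) * (N + D))) *
        Real.exp (c₁ + ((N + D) - N ^ 2 / (N + D)) / 8) := by
        gcongr
        exact one_sub_add_rpow_neg_le hN hD hc₁.le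
    _ = (N + 4 * c₁) ^ c₁ * (Real.exp (-c₁) * Real.exp (-(D / (4 * (N + D)) * (N + D))) *
        Real.exp (c₁ + ((N + D) - N ^ 2 / (N + D)) / 8)) := by ring
    _ ≤ _ := by gcongr

/-- **Lemma 20.** For `Q ~ χ²_n` with `n > 2`:
(a) for all `c₁, c₂ > 0`, `E(Q^{c₁} e^{−c₂/Q}) ≥ (n−2)^{c₁} e^{−c₂/(n−2)}`;
(b) there is an absolute constant `C > 0` such that for all `c₁ ≥ 1/4` and
`0 < c₂ < n²/36`,
`E(Q^{c₁} e^{−c₂/Q}) ≤ (n+6√c₂)^{c₁} e^{−c₂/(n+6√c₂)} + (C√c₁+√n)^{2c₁} e^{−2c₂/(n+6√c₂)}`. -/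
theorem chi_squared_moment_bounds :
    (∀ (n : ℕ), 2 < n → ∀ c₁ c₂ : ℝ, 0 < c₁ → 0 < c₂ →
      ((n : ℝ) - 2) ^ c₁ * Real.exp (-(c₂ / ((n : ℝ) - 2))) ≤ chiSqMoment n c₁ c₂) ∧
    ∃ C : ℝ, 0 < C ∧ ∀ (n : ℕ), 2 < n → ∀ c₁ c₂ : ℝ,
      (1 : ℝ) / 4 ≤ c₁ → 0 < c₂ → c₂ < (n : ℝ) ^ 2 / 36 →
      chiSqMoment n c₁ c₂ ≤
        ((n : ℝ) + 6 * Real.sqrt c₂) ^ c₁ *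
            Real.exp (-(c₂ / ((n : ℝ) + 6 * Real.sqrt c₂))) +
          (C * Real.sqrt c₁ + Real.sqrt n) ^ (2 * c₁) *
            Real.exp (-(2 * c₂ / ((n : ℝ) + 6 * Real.sqrt c₂))) := by
  refine ⟨fun n hn c₁ c₂ hc₁ hc₂ => le_chiSqMoment hn hc₁ hc₂.le, 2, two_pos, ?_⟩
  intro n hn c₁ c₂ hc₁ hc₂ _
  exact chiSqMoment_le (by omega) (by linarith) hc₂.le
end
end
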